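/- Let k, k', d₀, d, s be natural numbers with k' ≤ k, k ≥ 1 and d₀ ≥ 1. Let 𝒬 and 𝒫 be finite sets of real polynomials in k variables with card 𝒫 = s, such that every Q ∈ 𝒬 has total degree at most d₀ and every P ∈ 𝒫 has total degree at most d. Let Z = {x ∈ ℝ^k : Q(x) = 0 for all Q ∈ 𝒬} and assume the Hausdorff dimension of Z is at most k'. Then every realization R(σ,Z) of a sign condition σ on 𝒫 has finitely many connected components, and the sum over all sign conditions σ ∈ {−1,0,1}^𝒫 of the number of connected components of R(σ,Z) is at most ∑_{j=0}^{k'} 4^j · binom(s+1, j) · ( binom(k+1, k−k'+j+1) · (2d₀)^{k−k'} · d^j · (max(2d₀, d))^{k'−j} + 2(k−j+1) ). -/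

import Mathlib

open MvPolynomial ENNReal

open Classical in
/-- The degree `(a, b)` part of the ideal generated by bihomogeneous elements. -/
noncomputable def bidegIdeal {A : Type*} [CommRing A] [Algebra ℝ A] (U V : Submodule ℝ A)
    (T : Finset (A × ℕ × ℕ)) (a b : ℕ) : Submodule ℝ A :=
  T.sup fun f => Submodule.span ℝ {f.1} * (U ^ (a - f.2.1) * V ^ (b - f.2.2))

/-- In all large bidegrees, the ideal has codimension at most `n`. -/
def BidegCodimLE {A : Type*} [CommRing A] [Algebra ℝ A] (U V : Submodule ℝ A)
    (T : Finset (A × ℕ × ℕ)) (n : ℕ) : Prop :=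
  ∃ N, ∀ a b, N ≤ a → N ≤ b → ∃ E : Submodule ℝ A, FiniteDimensional ℝ E ∧
    Module.finrank ℝ E ≤ n ∧ U ^ a * V ^ b ≤ bidegIdeal U V T a b ⊔ E

section BidegCodim

variable {A : Type*} [CommRing A] [Algebra ℝ A] {U V : Submodule ℝ A}

lemma bidegIdeal_mono {S T : Finset (A × ℕ × ℕ)} (h : S ⊆ T) (a b : ℕ) :
    bidegIdeal U V S a b ≤ bidegIdeal U V T a b :=
  Finset.sup_mono h

lemma BidegCodimLE.mono {S T : Finset (A × ℕ × ℕ)} {n n' : ℕ} (h : S ⊆ T) (hn : n ≤ n')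
    (H : BidegCodimLE U V S n) : BidegCodimLE U V T n' := by
  obtain ⟨N, hN⟩ := H
  refine ⟨N, fun a b ha hb => ?_⟩
  obtain ⟨E, h1, h2, h3⟩ := hN a b ha hb
  exact ⟨E, h1, h2.trans hn, h3.trans (sup_le_sup_right (bidegIdeal_mono h a b) _)⟩

lemma le_bidegIdeal {T : Finset (A × ℕ × ℕ)} {f : A × ℕ × ℕ} (hf : f ∈ T) (a b : ℕ) :
    Submodule.span ℝ {f.1} * (U ^ (a - f.2.1) * V ^ (b - f.2.2)) ≤ bidegIdeal U V T a b :=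
  Finset.le_sup (f := fun f : A × ℕ × ℕ =>
    Submodule.span ℝ {f.1} * (U ^ (a - f.2.1) * V ^ (b - f.2.2))) hf

open Classical in
lemma bidegIdeal_insert (T : Finset (A × ℕ × ℕ)) (f : A × ℕ × ℕ) (a b : ℕ) :
    bidegIdeal U V (insert f T) a b =
      Submodule.span ℝ {f.1} * (U ^ (a - f.2.1) * V ^ (b - f.2.2)) ⊔ bidegIdeal U V T a b :=
  Finset.sup_insert

lemma Submodule.mul_finset_sup {κ : Type*} (S : Submodule ℝ A) (T : Finset κ)
    (F : κ → Submodule ℝ A) : S * T.sup F = T.sup fun i => S * F i := by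
  classical
  induction T using Finset.induction_on with
  | empty => simp
  | insert a s _ ih => rw [Finset.sup_insert, Finset.sup_insert, Submodule.mul_sup, ih]

lemma span_mul_bidegIdeal_le (T : Finset (A × ℕ × ℕ)) :
    ∃ N, ∀ f d e, f ∈ U ^ d * V ^ e → ∀ a b, N + d ≤ a → N + e ≤ b →
      Submodule.span ℝ {f} * bidegIdeal U V T (a - d) (b - e) ≤ bidegIdeal U V T a b := by
  refine ⟨T.sup (fun g => g.2.1 + g.2.2), fun f d e hf a b ha hb => ?_⟩
  rw [bidegIdeal, Submodule.mul_finset_sup]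
  refine Finset.sup_le fun g hg => ?_
  have hgN : g.2.1 + g.2.2 ≤ T.sup (fun g => g.2.1 + g.2.2) :=
    Finset.le_sup (f := fun g : A × ℕ × ℕ => g.2.1 + g.2.2) hg
  refine le_trans ?_ (le_bidegIdeal hg a b)
  have h1 : Submodule.span ℝ {f} ≤ U ^ d * V ^ e := by
    rw [Submodule.span_le]; simpa using hf
  calc Submodule.span ℝ {f} * (Submodule.span ℝ {g.1} *
        (U ^ (a - d - g.2.1) * V ^ (b - e - g.2.2)))
      ≤ (U ^ d * V ^ e) * (Submodule.span ℝ {g.1} *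
        (U ^ (a - d - g.2.1) * V ^ (b - e - g.2.2))) := mul_le_mul_left h1 _
    _ = Submodule.span ℝ {g.1} * (U ^ (d + (a - d - g.2.1)) * V ^ (e + (b - e - g.2.2))) := by
        rw [pow_add, pow_add]; ring
    _ = _ := by
        congr 3 <;> omega

open Classical in
lemma BidegCodimLE.mul {T : Finset (A × ℕ × ℕ)} {f g : A} {d e d' e' n n' : ℕ}
    (hf : f ∈ U ^ d * V ^ e) (H : BidegCodimLE U V (insert (f, d, e) T) n)
    (H' : BidegCodimLE U V (insert (g, d', e') T) n') :
    BidegCodimLE U V (insert (f * g, d + d', e + e') T) (n + n') := by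
  obtain ⟨N, hN⟩ := H
  obtain ⟨N', hN'⟩ := H'
  obtain ⟨N'', hN''⟩ := span_mul_bidegIdeal_le (U := U) (V := V) T
  refine ⟨N + (N' + d + e) + (N'' + d + e), fun a b ha hb => ?_⟩
  obtain ⟨E, h1, h2, h3⟩ := hN a b (by omega) (by omega)
  obtain ⟨E', h1', h2', h3'⟩ := hN' (a - d) (b - e) (by omega) (by omega)
  refine ⟨E ⊔ E'.map (LinearMap.mulLeft ℝ f), inferInstance, ?_, ?_⟩
  · refine (Submodule.finrank_add_le_finrank_add_finrank _ _).trans (add_le_add h2 ?_)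
    exact (Submodule.finrank_map_le _ _).trans h2'
  · refine h3.trans ?_
    rw [bidegIdeal_insert] at h3' ⊢
    rw [bidegIdeal_insert]
    have key : Submodule.span ℝ {f} * (U ^ (a - d) * V ^ (b - e)) ≤
        Submodule.span ℝ {f * g} * (U ^ (a - (d + d')) * V ^ (b - (e + e'))) ⊔
          bidegIdeal U V T a b ⊔ E'.map (LinearMap.mulLeft ℝ f) := by
      refine (mul_le_mul_right h3' _).trans ?_
      rw [Submodule.mul_sup, Submodule.mul_sup]
      refine sup_le_sup (sup_le_sup ?_ (hN'' f d e hf a b (by omega) (by omega))) ?_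
      · rw [← mul_assoc, Submodule.span_mul_span, Set.singleton_mul_singleton,
          Nat.sub_sub, Nat.sub_sub]
      · rw [Submodule.mul_le]
        intro x hx y hy
        obtain ⟨c, rfl⟩ := Submodule.mem_span_singleton.1 hx
        exact ⟨c • y, E'.smul_mem _ hy, by simp⟩
    refine sup_le (sup_le (key.trans ?_) ?_) ?_
    · exact sup_le (le_sup_left) (le_sup_right.trans le_sup_right)
    · exact le_sup_right.trans le_sup_left
    · exact le_sup_left.trans le_sup_right

open Classical in
lemma BidegCodimLE.one (T : Finset (A × ℕ × ℕ)) :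
    BidegCodimLE U V (insert (1, 0, 0) T) 0 := by
  refine ⟨0, fun a b _ _ => ⟨⊥, inferInstance, by simp, ?_⟩⟩
  rw [bidegIdeal_insert]
  refine le_trans ?_ (le_sup_left.trans le_sup_left)
  rw [← Submodule.one_eq_span]; simp

open Classical in
lemma BidegCodimLE.pow {T : Finset (A × ℕ × ℕ)} {f : A} {d e n : ℕ}
    (hf : f ∈ U ^ d * V ^ e) (H : BidegCodimLE U V (insert (f, d, e) T) n) (r : ℕ) :
    BidegCodimLE U V (insert (f ^ r, r * d, r * e) T) (r * n) := by
  induction r with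
  | zero => simpa using BidegCodimLE.one T
  | succ r ih =>
    have := BidegCodimLE.mul hf H ih
    convert this using 1
    · rw [pow_succ']; congr 3 <;> ring
    · ring

end BidegCodim

/-- The Vandermonde combination `∑ r, t ^ r • u r`. -/
def vandermondeForm {A : Type*} [AddCommGroup A] [Module ℝ A] {n : ℕ} (u : Fin n → A) (t : ℝ) : A :=
  ∑ r : Fin n, t ^ (r : ℕ) • u r

lemma span_range_le_span_vandermondeForm {A : Type*} [AddCommGroup A] [Module ℝ A] {n : ℕ}
    (u : Fin n → A) (P : Finset ℝ) (hP : n ≤ P.card) :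
    Submodule.span ℝ (Set.range u) ≤ P.sup fun t => Submodule.span ℝ {vandermondeForm u t} := by
  obtain ⟨P', hPP, hP'⟩ := Finset.exists_subset_card_eq hP
  refine le_trans ?_ (Finset.sup_mono hPP)
  let e := P'.equivFinOfCardEq hP'
  let v : Fin n → ℝ := fun i => (e.symm i : ℝ)
  have hv : Function.Injective v := Subtype.val_injective.comp e.symm.injective
  have hdet : IsUnit (Matrix.vandermonde v).det :=
    (Matrix.det_vandermonde_ne_zero_iff.2 hv).isUnit
  rw [Submodule.span_le]
  rintro _ ⟨r, rfl⟩
  have hr : u r = ∑ t, (Matrix.vandermonde v)⁻¹ r t • vandermondeForm u (v t) := by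
    have h1 := congrFun (Matrix.nonsing_inv_mul _ hdet)  r
    simp only [vandermondeForm, Finset.smul_sum, smul_smul]
    rw [Finset.sum_comm]
    simp only [← Finset.sum_smul]
    have h2 : ∀ j : Fin n, ∑ i, (Matrix.vandermonde v)⁻¹ r i * v i ^ (j : ℕ) = (1 : Matrix _ _ ℝ) r j :=
      fun j => congrFun h1 j
    simp only [h2, Matrix.one_apply, ite_smul, one_smul, zero_smul]
    simp
  rw [SetLike.mem_coe, hr]
  refine Submodule.sum_mem _ fun t _ => Submodule.smul_mem _ _ ?_
  have := Finset.le_sup (f := fun t => Submodule.span ℝ {vandermondeForm u t})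
    (e.symm t).2
  exact this (Submodule.mem_span_singleton_self _)

section VandermondeSystem

variable {A : Type*} [CommRing A] [Algebra ℝ A]

lemma pow_succ_le_mul_pow_sup_span {U X : Submodule ℝ A} {f : A} (hf : f ∈ U)
    (h : U ≤ X ⊔ Submodule.span ℝ {f}) (a : ℕ) :
    U ^ (a + 1) ≤ X * U ^ a ⊔ Submodule.span ℝ {f ^ (a + 1)} := by
  induction a with
  | zero => simpa using h
  | succ a ih =>
    have hfa : Submodule.span ℝ {f ^ (a + 1)} ≤ U ^ (a + 1) := by
      rw [Submodule.span_le]; simpa using Submodule.pow_mem_pow U hf (a + 1)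
    calc U ^ (a + 1 + 1) = U * U ^ (a + 1) := pow_succ' _ _
      _ ≤ U * (X * U ^ a ⊔ Submodule.span ℝ {f ^ (a + 1)}) := mul_le_mul_right ih _
      _ = X * U ^ (a + 1) ⊔ U * Submodule.span ℝ {f ^ (a + 1)} := by
          rw [Submodule.mul_sup, pow_succ' U a]; congr 1; ring
      _ ≤ _ := by
          refine sup_le le_sup_left ((mul_le_mul_left h _).trans ?_)
          rw [Submodule.sup_mul]
          refine sup_le ((mul_le_mul_right hfa _).trans le_sup_left) ?_
          rw [Submodule.span_mul_span, Set.singleton_mul_singleton, ← pow_succ']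
          exact le_sup_right

variable {k m : ℕ} (u : Fin (k + 1) → A) (v : Fin (m + 1) → A)

lemma vandermondeForm_mem_span {n : ℕ} (u : Fin n → A) (t : ℝ) :
    vandermondeForm u t ∈ Submodule.span ℝ (Set.range u) :=
  Submodule.sum_mem _ fun r _ => Submodule.smul_mem _ _ (Submodule.subset_span ⟨r, rfl⟩)

open Classical in
/-- Vandermonde forms in the two groups of variables, with their bidegrees. -/
noncomputable def vandermondeGens (P Q : Finset ℝ) : Finset (A × ℕ × ℕ) :=
  P.image (fun t => (vandermondeForm u t, 1, 0)) ∪ Q.image (fun t => (vandermondeForm v t, 0, 1))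

local notation "SU" => Submodule.span ℝ (Set.range u)
local notation "SV" => Submodule.span ℝ (Set.range v)

lemma left_mul_le_bidegIdeal (P Q : Finset ℝ) (a b : ℕ) :
    (P.sup fun t => Submodule.span ℝ {vandermondeForm u t}) * (SU ^ a * SV ^ b) ≤
      bidegIdeal SU SV (vandermondeGens u v P Q) (a + 1) b := by
  classical
  rw [mul_comm, Submodule.mul_finset_sup]
  refine Finset.sup_le fun t ht => ?_
  rw [mul_comm]
  have := le_bidegIdeal (U := SU) (V := SV) (T := vandermondeGens u v P Q)
    (f := (vandermondeForm u t, 1, 0))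
    (Finset.mem_union_left _ (Finset.mem_image_of_mem _ ht)) (a + 1) b
  simpa using this

lemma right_mul_le_bidegIdeal (P Q : Finset ℝ) (a b : ℕ) :
    (Q.sup fun t => Submodule.span ℝ {vandermondeForm v t}) * (SU ^ a * SV ^ b) ≤
      bidegIdeal SU SV (vandermondeGens u v P Q) a (b + 1) := by
  classical
  rw [mul_comm, Submodule.mul_finset_sup]
  refine Finset.sup_le fun t ht => ?_
  rw [mul_comm]
  have := le_bidegIdeal (U := SU) (V := SV) (T := vandermondeGens u v P Q)
    (f := (vandermondeForm v t, 0, 1))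
    (Finset.mem_union_right _ (Finset.mem_image_of_mem _ ht)) a (b + 1)
  simpa using this

lemma bidegCodimLE_vandermondeGens (P Q : Finset ℝ) (h : P.card + Q.card = k + m) :
    BidegCodimLE SU SV (vandermondeGens u v P Q) (if P.card = k then 1 else 0) := by
  classical
  refine ⟨1, fun a b ha hb => ?_⟩
  obtain ⟨a, rfl⟩ := Nat.exists_eq_add_of_le' ha
  obtain ⟨b, rfl⟩ := Nat.exists_eq_add_of_le' hb
  rcases lt_trichotomy P.card k with hP | hP | hP
  · refine ⟨⊥, inferInstance, by simp, ?_⟩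
    rw [sup_bot_eq]
    refine le_trans ?_ (right_mul_le_bidegIdeal u v P Q (a + 1) b)
    have := span_range_le_span_vandermondeForm v Q (by omega)
    calc SU ^ (a + 1) * SV ^ (b + 1) = SV * (SU ^ (a + 1) * SV ^ b) := by ring
      _ ≤ _ := mul_le_mul_left this _
  · obtain ⟨s, hs⟩ := Infinite.exists_notMem_finset P
    obtain ⟨s', hs'⟩ := Infinite.exists_notMem_finset Q
    have h1 := span_range_le_span_vandermondeForm u (insert s P)
      (by rw [Finset.card_insert_of_notMem hs]; omega)
    have h2 := span_range_le_span_vandermondeForm v (insert s' Q)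
      (by rw [Finset.card_insert_of_notMem hs']; omega)
    rw [Finset.sup_insert, sup_comm] at h1 h2
    have h3 := pow_succ_le_mul_pow_sup_span (vandermondeForm_mem_span u s) h1 a
    have h4 := pow_succ_le_mul_pow_sup_span (vandermondeForm_mem_span v s') h2 b
    refine ⟨Submodule.span ℝ {vandermondeForm u s ^ (a + 1) * vandermondeForm v s' ^ (b + 1)},
      inferInstance, ?_, ?_⟩
    · simp only [hP, if_true]
      exact (finrank_span_le_card _).trans (by simp)
    · have hs : Submodule.span ℝ {vandermondeForm u s ^ (a + 1)} ≤ SU ^ (a + 1) := by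
        rw [Submodule.span_le]
        simpa using Submodule.pow_mem_pow _ (vandermondeForm_mem_span u s) (a + 1)
      calc SU ^ (a + 1) * SV ^ (b + 1) ≤ _ := mul_le_mul_left h3 _
        _ = (P.sup fun t => Submodule.span ℝ {vandermondeForm u t}) * (SU ^ a * SV ^ (b + 1)) ⊔
            Submodule.span ℝ {vandermondeForm u s ^ (a + 1)} * SV ^ (b + 1) := by
            rw [Submodule.sup_mul, mul_assoc]
        _ ≤ _ := by
            refine sup_le ((left_mul_le_bidegIdeal u v P Q a (b + 1)).trans le_sup_left) ?_
            refine (mul_le_mul_right h4 _).trans ?_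
            rw [Submodule.mul_sup, Submodule.span_mul_span, Set.singleton_mul_singleton]
            refine sup_le_sup ((mul_le_mul_left hs _).trans ?_) le_rfl
            refine le_trans (le_of_eq ?_) (right_mul_le_bidegIdeal u v P Q (a + 1) b)
            ring
  · refine ⟨⊥, inferInstance, by simp, ?_⟩
    rw [sup_bot_eq]
    refine le_trans ?_ (left_mul_le_bidegIdeal u v P Q a (b + 1))
    have := span_range_le_span_vandermondeForm u P (by omega)
    calc SU ^ (a + 1) * SV ^ (b + 1) = SU * (SU ^ a * SV ^ (b + 1)) := by ring
      _ ≤ _ := mul_le_mul_left this _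

open Classical in
lemma vandermondeGens_insert_left (P Q : Finset ℝ) (t : ℝ) :
    vandermondeGens u v (insert t P) Q =
      insert (vandermondeForm u t, 1, 0) (vandermondeGens u v P Q) := by
  simp [vandermondeGens, Finset.image_insert, Finset.insert_union]

open Classical in
lemma vandermondeGens_insert_right (P Q : Finset ℝ) (t : ℝ) :
    vandermondeGens u v P (insert t Q) =
      insert (vandermondeForm v t, 0, 1) (vandermondeGens u v P Q) := by
  simp [vandermondeGens, Finset.image_insert, Finset.union_insert]

open Classical in
/-- Products of `D` equal forms in the first group and one form in the second group. -/
lemma bidegCodimLE_mixed (D : ℕ) (node : ℕ → ℝ) (hn : Function.Injective node) (r p : ℕ)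
    (P Q : Finset ℝ) (hp : P.card = p) (h : p + Q.card + r = k + m)
    (hP : ∀ i < r, node i ∉ P) (hQ : ∀ i < r, node i ∉ Q) :
    BidegCodimLE SU SV (vandermondeGens u v P Q ∪ (Finset.range r).image fun i =>
        (vandermondeForm u (node i) ^ D * vandermondeForm v (node i), D, 1))
      (if p ≤ k then r.choose (k - p) * D ^ (k - p) else 0) := by
  induction r generalizing p P Q with
  | zero =>
    refine (bidegCodimLE_vandermondeGens u v P Q (by omega)).mono (by simp) ?_
    subst hp
    split_ifs <;> simp_all
  | succ r ih =>
    have hr1 : ∀ i < r, node i ≠ node r := fun i hi h => by have := hn h; omega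
    rw [Finset.range_add_one, Finset.image_insert, Finset.union_insert]
    have h1 := ih (p + 1) (insert (node r) P) Q
      (by rw [Finset.card_insert_of_notMem (hP r (by omega)), hp]) (by omega)
      (fun i hi => by simp [hr1 i hi, hP i (by omega)]) (fun i hi => hQ i (by omega))
    have h2 := ih p P (insert (node r) Q) hp
      (by rw [Finset.card_insert_of_notMem (hQ r (by omega))]; omega)
      (fun i hi => hP i (by omega)) (fun i hi => by simp [hr1 i hi, hQ i (by omega)])
    rw [vandermondeGens_insert_left, Finset.insert_union] at h1
    rw [vandermondeGens_insert_right, Finset.insert_union] at h2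
    have hm : vandermondeForm u (node r) ∈ SU ^ 1 * SV ^ 0 := by
      simpa using vandermondeForm_mem_span u (node r)
    have hm' : vandermondeForm u (node r) ^ D ∈ SU ^ (D * 1) * SV ^ (D * 0) := by
      simpa using Submodule.pow_mem_pow _ (vandermondeForm_mem_span u (node r)) D
    have h3 := BidegCodimLE.mul hm' (h1.pow hm D) h2
    simp only [mul_one, mul_zero, add_zero, zero_add] at h3
    refine h3.mono le_rfl ?_
    by_cases hpk : p + 1 ≤ k
    · obtain ⟨q, rfl⟩ := Nat.exists_eq_add_of_le hpk
      rw [if_pos hpk, if_pos (by omega), if_pos (by omega),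
        show p + 1 + q - (p + 1) = q by omega, show p + 1 + q - p = q + 1 by omega,
        Nat.choose_succ_succ, pow_succ]
      exact le_of_eq (by ring)
    · rw [if_neg hpk]
      split_ifs with h
      · rw [show k - p = 0 by omega]; simp
      · simp

open Classical in
lemma bidegCodimLE_special {κ : Type*} (D : ℕ) (node : ℕ → ℝ) (hn : Function.Injective node)
    (I : Finset κ) (nodeI : κ → ℝ) (hI : Function.Injective nodeI)
    (hd : ∀ i j, node i ≠ nodeI j) (d : κ → ℕ) (r p : ℕ)
    (P : Finset ℝ) (hp : P.card = p) (h : p + I.card + r = k + m)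
    (hP : ∀ i, node i ∉ P) (hPI : ∀ i ∈ I, nodeI i ∉ P) :
    BidegCodimLE SU SV (vandermondeGens u v P ∅ ∪ ((Finset.range r).image fun i =>
        (vandermondeForm u (node i) ^ D * vandermondeForm v (node i), D, 1)) ∪
        I.image fun i => (vandermondeForm u (nodeI i) ^ d i, d i, 0))
      (if p + I.card ≤ k then
        r.choose (k - (p + I.card)) * (∏ i ∈ I, d i) * D ^ (k - (p + I.card)) else 0) := by
  induction I using Finset.induction_on generalizing p P with
  | empty =>
    simpa using bidegCodimLE_mixed u v D node hn r p P ∅ hp (by simpa using h)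
      (fun i _ => hP i) (by simp)
  | insert i I hi ih =>
    rw [Finset.image_insert, Finset.union_insert]
    rw [Finset.card_insert_of_notMem hi] at h ⊢
    have h1 := ih (p + 1) (insert (nodeI i) P)
      (by rw [Finset.card_insert_of_notMem (hPI i (Finset.mem_insert_self _ _)), hp]) (by omega)
      (fun j => by simp [hd, hP]) (fun j hj => by
        have : j ≠ i := fun h => hi (h ▸ hj)
        simp [hI.eq_iff, this, hPI j (Finset.mem_insert_of_mem hj)])
    rw [vandermondeGens_insert_left, Finset.insert_union, Finset.insert_union] at h1
    have hm : vandermondeForm u (nodeI i) ∈ SU ^ 1 * SV ^ 0 := by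
      simpa using vandermondeForm_mem_span u (nodeI i)
    have h2 := h1.pow hm (d i)
    simp only [mul_one, mul_zero] at h2
    refine h2.mono le_rfl ?_
    rw [show p + 1 + I.card = p + (I.card + 1) by omega, Finset.prod_insert hi]
    split_ifs
    · exact le_of_eq (by ring)
    · simp

end VandermondeSystem

lemma finite_setOf_not_surjective_homotopy {X Y : Type*} [AddCommGroup X] [Module ℝ X]
    [AddCommGroup Y] [Module ℝ Y] [FiniteDimensional ℝ Y] (φ K : X →ₗ[ℝ] Y)
    (hφ : Function.Surjective φ) :
    {t : ℝ | ¬ Function.Surjective (K + t • (φ - K))}.Finite := by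
  obtain ⟨ψ, hψ⟩ := φ.exists_rightInverse_of_surjective (LinearMap.range_eq_top.2 hφ)
  let M : Module.End ℝ Y := K ∘ₗ ψ
  have hfin : {μ : ℝ | M.HasEigenvalue μ}.Finite := Module.End.finite_hasEigenvalue M
  refine ((hfin.image fun μ => μ / (μ - 1)).insert 1).subset fun t ht => ?_
  by_cases h1 : t = 1
  · exact Or.inl h1
  refine Or.inr ⟨-t / (1 - t), ?_, ?_⟩
  · have hns : ¬ Function.Surjective ((K + t • (φ - K)) ∘ₗ ψ) := fun h => ht (by
      rw [LinearMap.coe_comp] at h; exact h.of_comp)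
    rw [← LinearMap.injective_iff_surjective, ← LinearMap.ker_eq_bot,
      Submodule.eq_bot_iff] at hns
    push Not at hns
    obtain ⟨y, hy, hy0⟩ := hns
    refine Module.End.hasEigenvalue_of_hasEigenvector (x := y)
      (Module.End.hasEigenvector_iff.2 ⟨Module.End.mem_eigenspace_iff.2 ?_, hy0⟩)
    have h2 : φ (ψ y) = y := LinearMap.congr_fun hψ y
    have h3 : K (ψ y) + t • (y - K (ψ y)) = 0 := by
      simpa [h2] using hy
    have h1' : 1 - t ≠ 0 := sub_ne_zero.2 (Ne.symm h1)
    change K (ψ y) = _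
    have h4 : (1 - t) • K (ψ y) = -t • y := by
      rw [sub_smul, one_smul, neg_smul, eq_neg_iff_add_eq_zero, ← h3, smul_sub]; abel
    rw [div_eq_inv_mul, mul_smul, ← h4, smul_smul, inv_mul_cancel₀ h1', one_smul]
  · have h1' : 1 - t ≠ 0 := sub_ne_zero.2 (Ne.symm h1)
    have : -t / (1 - t) - 1 ≠ 0 := by
      rw [div_sub_one h1']; exact div_ne_zero (by ring_nf; norm_num) h1'
    simp only
    rw [div_eq_iff this]; field_simp; ring

section Perturbation

variable {A : Type*} [CommRing A] [Algebra ℝ A]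

open Classical in
lemma finite_setOf_not_bidegIdeal_sup {U V : Submodule ℝ A} [FiniteDimensional ℝ U]
    [FiniteDimensional ℝ V] {κ : Type*} [Fintype κ] (d e : κ → ℕ) (f g : κ → A)
    (hf : ∀ i, f i ∈ U ^ d i * V ^ e i) (hg : ∀ i, g i ∈ U ^ d i * V ^ e i)
    (a b : ℕ) (hda : ∀ i, d i ≤ a) (heb : ∀ i, e i ≤ b) (E : Submodule ℝ A)
    [FiniteDimensional ℝ E]
    (hE : U ^ a * V ^ b ≤
      bidegIdeal U V (Finset.univ.image fun i => (g i, d i, e i)) a b ⊔ E) :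
    {t : ℝ | ¬ U ^ a * V ^ b ≤ bidegIdeal U V
      (Finset.univ.image fun i => (f i + t • (g i - f i), d i, e i)) a b ⊔ E}.Finite := by
  let W : κ → Submodule ℝ A := fun i => U ^ (a - d i) * V ^ (b - e i)
  let Y : Submodule ℝ A := U ^ a * V ^ b ⊔ E
  have hUV : (U ^ a * V ^ b).FG :=
    ((Module.Finite.iff_fg.1 ‹_›).pow a).mul ((Module.Finite.iff_fg.1 ‹_›).pow b)
  have : FiniteDimensional ℝ Y :=
    Module.Finite.iff_fg.2 (hUV.sup (Module.Finite.iff_fg.1 ‹_›))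
  let Φ : (κ → A) → ((∀ i, W i) × E) →ₗ[ℝ] A := fun h =>
    (∑ i, (LinearMap.mulLeft ℝ (h i)) ∘ₗ (W i).subtype ∘ₗ LinearMap.proj i ∘ₗ
      LinearMap.fst ℝ _ _) + E.subtype ∘ₗ LinearMap.snd ℝ _ _
  have hΦ : ∀ h x, Φ h x = ∑ i, h i * (x.1 i : A) + x.2 := fun h x => by
    simp [Φ, LinearMap.sum_apply]
  have hY : ∀ h : κ → A, (∀ i, h i ∈ U ^ d i * V ^ e i) → ∀ x, Φ h x ∈ Y := by
    intro h hh x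
    rw [hΦ]
    refine Submodule.add_mem_sup (Submodule.sum_mem _ fun i _ => ?_) x.2.2
    have := Submodule.mul_mem_mul (hh i) (x.1 i).2
    have he : U ^ d i * V ^ e i * W i = U ^ a * V ^ b := by
      conv_rhs => rw [← Nat.add_sub_of_le (hda i), ← Nat.add_sub_of_le (heb i), pow_add, pow_add]
      simp only [W]; ring
    rwa [he] at this
  have hrange : ∀ h : κ → A, LinearMap.range (Φ h) =
      bidegIdeal U V (Finset.univ.image fun i => (h i, d i, e i)) a b ⊔ E := by
    intro h
    apply le_antisymm
    · rintro _ ⟨x, rfl⟩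
      rw [hΦ]
      refine Submodule.add_mem_sup (Submodule.sum_mem _ fun i _ => ?_) x.2.2
      exact le_bidegIdeal (f := (h i, d i, e i))
        (Finset.mem_image_of_mem (fun i => (h i, d i, e i)) (Finset.mem_univ i)) a b
        (Submodule.mul_mem_mul (Submodule.mem_span_singleton_self _) (x.1 i).2)
    · refine sup_le (Finset.sup_le fun q hq => ?_) fun x hx => ⟨(0, ⟨x, hx⟩), by simp [hΦ]⟩
      obtain ⟨i, -, rfl⟩ := Finset.mem_image.1 hq
      rw [Submodule.mul_le]
      intro y hy z hz
      obtain ⟨c, rfl⟩ := Submodule.mem_span_singleton.1 hy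
      refine ⟨(Pi.single i (c • ⟨z, hz⟩), 0), ?_⟩
      rw [hΦ, Finset.sum_eq_single i]
      · simp
      · intro j _ hj; simp [hj]
      · simp
  let φ : ((∀ i, W i) × E) →ₗ[ℝ] Y := (Φ g).codRestrict Y (hY g hg)
  let K : ((∀ i, W i) × E) →ₗ[ℝ] Y := (Φ f).codRestrict Y (hY f hf)
  have hφ : Function.Surjective φ := by
    rintro ⟨y, hy⟩
    have : y ∈ LinearMap.range (Φ g) := by
      rw [hrange]; exact (sup_le hE le_sup_right) hy
    obtain ⟨x, hx⟩ := this
    exact ⟨x, Subtype.ext hx⟩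
  refine (finite_setOf_not_surjective_homotopy φ K hφ).subset fun t ht hs => ht ?_
  rw [← hrange]
  intro y hy
  obtain ⟨x, hx⟩ := hs ⟨y, Submodule.mem_sup_left hy⟩
  refine ⟨x, ?_⟩
  have hx' : Φ f x + t • (Φ g x - Φ f x) = y := congrArg Subtype.val hx
  rw [← hx']
  simp only [hΦ, add_mul, sub_mul, smul_mul_assoc, Finset.sum_add_distrib, Finset.sum_sub_distrib,
    ← Finset.smul_sum, smul_sub, smul_add]
  abel

end Perturbation

section Bezout

variable {k m : ℕ}

/-- The functions `1, x₁, …, x_k` of the first group of variables. -/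
def leftCoord (k m : ℕ) : Fin (k + 1) → ((Fin k → ℝ) × (Fin m → ℝ) → ℝ) :=
  Fin.cons 1 fun r z => z.1 r

/-- The functions `1, y₁, …, y_m` of the second group of variables. -/
def rightCoord (k m : ℕ) : Fin (m + 1) → ((Fin k → ℝ) × (Fin m → ℝ) → ℝ) :=
  Fin.cons 1 fun r z => z.2 r

/-- Affine functions of the first group of variables. -/
def leftAffine (k m : ℕ) : Submodule ℝ ((Fin k → ℝ) × (Fin m → ℝ) → ℝ) :=
  Submodule.span ℝ (Set.range (leftCoord k m))

/-- Affine functions of the second group of variables. -/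
def rightAffine (k m : ℕ) : Submodule ℝ ((Fin k → ℝ) × (Fin m → ℝ) → ℝ) :=
  Submodule.span ℝ (Set.range (rightCoord k m))

instance : FiniteDimensional ℝ (leftAffine k m) :=
  FiniteDimensional.span_of_finite ℝ (Set.finite_range _)

instance : FiniteDimensional ℝ (rightAffine k m) :=
  FiniteDimensional.span_of_finite ℝ (Set.finite_range _)

lemma one_mem_leftAffine : (1 : (Fin k → ℝ) × (Fin m → ℝ) → ℝ) ∈ leftAffine k m :=
  Submodule.subset_span ⟨0, rfl⟩

lemma one_mem_rightAffine : (1 : (Fin k → ℝ) × (Fin m → ℝ) → ℝ) ∈ rightAffine k m :=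
  Submodule.subset_span ⟨0, rfl⟩

lemma fst_mem_leftAffine (r : Fin k) :
    (fun z : (Fin k → ℝ) × (Fin m → ℝ) => z.1 r) ∈ leftAffine k m :=
  Submodule.subset_span ⟨r.succ, by simp [leftCoord]⟩

lemma snd_mem_rightAffine (r : Fin m) :
    (fun z : (Fin k → ℝ) × (Fin m → ℝ) => z.2 r) ∈ rightAffine k m :=
  Submodule.subset_span ⟨r.succ, by simp [rightCoord]⟩

lemma contDiff_of_mem_bidegree {a b : ℕ} {f : (Fin k → ℝ) × (Fin m → ℝ) → ℝ}
    (hf : f ∈ leftAffine k m ^ a * rightAffine k m ^ b) : ContDiff ℝ 1 f := by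
  let S : Subalgebra ℝ ((Fin k → ℝ) × (Fin m → ℝ) → ℝ) :=
    { carrier := {f | ContDiff ℝ 1 f}
      mul_mem' := fun {f g} (hf : ContDiff ℝ 1 f) (hg : ContDiff ℝ 1 g) => hf.mul hg
      add_mem' := fun {f g} (hf : ContDiff ℝ 1 f) (hg : ContDiff ℝ 1 g) => hf.add hg
      algebraMap_mem' := fun r =>
        show ContDiff ℝ 1 fun _ : (Fin k → ℝ) × (Fin m → ℝ) => r from contDiff_const }
  have hS : S.toSubmodule * S.toSubmodule ≤ S.toSubmodule := by
    rw [Submodule.mul_le]; exact fun _ h _ h' => S.mul_mem h h'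
  have hpow : ∀ W ≤ S.toSubmodule, ∀ n : ℕ, W ^ n ≤ S.toSubmodule := by
    intro W hW n
    induction n with
    | zero => rw [pow_zero, Submodule.one_le]; exact S.one_mem
    | succ n ih => rw [pow_succ]; exact (mul_le_mul' ih hW).trans hS
  have hL : leftAffine k m ≤ S.toSubmodule := by
    rw [leftAffine, Submodule.span_le]
    rintro _ ⟨r, rfl⟩
    refine Fin.cases ?_ (fun r => ?_) r
    · exact S.one_mem
    · change ContDiff ℝ 1 fun z : (Fin k → ℝ) × (Fin m → ℝ) => z.1 r
      fun_prop
  have hR : rightAffine k m ≤ S.toSubmodule := by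
    rw [rightAffine, Submodule.span_le]
    rintro _ ⟨r, rfl⟩
    refine Fin.cases ?_ (fun r => ?_) r
    · exact S.one_mem
    · change ContDiff ℝ 1 fun z : (Fin k → ℝ) × (Fin m → ℝ) => z.2 r
      fun_prop
  exact (mul_le_mul' (hpow _ hL a) (hpow _ hR b)).trans hS hf

lemma exists_mem_separating {z z' : (Fin k → ℝ) × (Fin m → ℝ)} (h : z ≠ z') :
    ∃ f ∈ leftAffine k m * rightAffine k m, f z = 1 ∧ f z' = 0 := by
  by_cases h1 : z.1 = z'.1
  · have h2 : z.2 ≠ z'.2 := fun h2 => h (Prod.ext h1 h2)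
    obtain ⟨r, hr⟩ := Function.ne_iff.1 h2
    refine ⟨1 * (z.2 r - z'.2 r)⁻¹ • ((fun z => z.2 r) - (z'.2 r) • 1),
      Submodule.mul_mem_mul one_mem_leftAffine (Submodule.smul_mem _ _ (Submodule.sub_mem _
        (snd_mem_rightAffine r) (Submodule.smul_mem _ _ one_mem_rightAffine))), ?_, ?_⟩
    · simp [inv_mul_cancel₀ (sub_ne_zero.2 hr)]
    · simp
  · obtain ⟨r, hr⟩ := Function.ne_iff.1 h1
    refine ⟨((z.1 r - z'.1 r)⁻¹ • ((fun z => z.1 r) - (z'.1 r) • 1)) * 1,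
      Submodule.mul_mem_mul (Submodule.smul_mem _ _ (Submodule.sub_mem _
        (fst_mem_leftAffine r) (Submodule.smul_mem _ _ one_mem_leftAffine)))
        one_mem_rightAffine, ?_, ?_⟩
    · simp [inv_mul_cancel₀ (sub_ne_zero.2 hr)]
    · simp

lemma exists_mem_interpolating {ι : Type*} [Fintype ι] [DecidableEq ι]
    (z : ι → (Fin k → ℝ) × (Fin m → ℝ))
    (hz : Function.Injective z) (a b : ℕ) (ha : Fintype.card ι ≤ a) (hb : Fintype.card ι ≤ b)
    (i : ι) : ∃ f ∈ leftAffine k m ^ a * rightAffine k m ^ b, ∀ j, f (z j) = if j = i then 1 else 0 := by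
  have h : ∀ j : ι, ∃ f ∈ leftAffine k m * rightAffine k m, f (z i) = 1 ∧ (j ≠ i → f (z j) = 0) := by
    intro j
    by_cases hj : j = i
    · refine ⟨1, ?_, by simp, by simp [hj]⟩
      simpa using Submodule.mul_mem_mul (one_mem_leftAffine (k := k) (m := m)) one_mem_rightAffine
    · obtain ⟨f, h1, h2, h3⟩ := exists_mem_separating (hz.ne (Ne.symm hj))
      exact ⟨f, h1, h2, fun _ => h3⟩
  choose f hf h1 h2 using h
  refine ⟨∏ j, f j, ?_, fun j => ?_⟩
  · have h3 : ∀ s : Finset ι, ∏ j ∈ s, f j ∈ (leftAffine k m * rightAffine k m) ^ s.card := by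
      intro s
      induction s using Finset.induction_on with
      | empty => simp
      | insert j s hj ih =>
        rw [Finset.prod_insert hj, Finset.card_insert_of_notMem hj, pow_succ']
        exact Submodule.mul_mem_mul (hf j) ih
    have h4 := h3 Finset.univ
    rw [mul_pow] at h4
    have h5 := mul_le_mul' (pow_le_pow_right' (Submodule.one_le.2 one_mem_leftAffine) ha)
      (pow_le_pow_right' (Submodule.one_le.2 (one_mem_rightAffine (k := k) (m := m))) hb)
    exact h5 h4
  · rw [Finset.prod_apply]
    split_ifs with h
    · subst h; exact Finset.prod_eq_one fun l _ => h1 l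
    · exact Finset.prod_eq_zero (Finset.mem_univ j) (h2 j h)

/-- Nondegenerate common zeros persist under small perturbations of the equations. -/
lemma eventually_exists_zero_homotopy {X : Type*} [NormedAddCommGroup X] [NormedSpace ℝ X]
    [FiniteDimensional ℝ X] {κ : Type*} [Fintype κ] (hκ : Fintype.card κ = Module.finrank ℝ X)
    (f g : κ → X → ℝ) (hf : ∀ i, ContDiff ℝ 1 (f i)) (hg : ∀ i, ContDiff ℝ 1 (g i)) (p : X)
    (hp : ∀ i, f i p = 0) (hnd : ∀ v, (∀ i, fderiv ℝ (f i) p v = 0) → v = 0) (B : Set X)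
    (hB : B ∈ nhds p) :
    ∀ᶠ t : ℝ in nhds 0, ∃ z ∈ B, ∀ i, (f i + t • (g i - f i)) z = 0 := by
  have : CompleteSpace X := FiniteDimensional.complete ℝ X
  let H : ℝ × X → ℝ × (κ → ℝ) := fun w => (w.1, fun i => f i w.2 + w.1 * (g i w.2 - f i w.2))
  have hH : ContDiff ℝ 1 H := by
    refine contDiff_fst.prodMk (contDiff_pi.2 fun i => ?_)
    have h1 := (hf i).comp (contDiff_snd (𝕜 := ℝ) (E := ℝ) (F := X))
    have h2 := (hg i).comp (contDiff_snd (𝕜 := ℝ) (E := ℝ) (F := X))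
    exact h1.add (contDiff_fst.mul (h2.sub h1))
  have hs : HasStrictFDerivAt H (fderiv ℝ H (0, p)) (0, p) :=
    hH.contDiffAt.hasStrictFDerivAt (by norm_num)
  have hinj : LinearMap.ker (fderiv ℝ H (0, p) : ℝ × X →ₗ[ℝ] ℝ × (κ → ℝ)) = ⊥ := by
    rw [Submodule.eq_bot_iff]
    rintro ⟨τ, v⟩ hv
    have hv' : fderiv ℝ H (0, p) (τ, v) = 0 := hv
    have h1 : HasFDerivAt (fun w => (H w).1) ((ContinuousLinearMap.fst ℝ _ _).comp
      (fderiv ℝ H (0, p))) (0, p) := (ContinuousLinearMap.fst ℝ ℝ (κ → ℝ)).hasFDerivAt.comp _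
        hs.hasFDerivAt
    have h1' : HasFDerivAt (fun w => (H w).1) (ContinuousLinearMap.fst ℝ ℝ X) (0, p) :=
      hasFDerivAt_fst
    have hτ : τ = 0 := by
      have := DFunLike.congr_fun (h1'.unique h1) (τ, v)
      simpa [hv'] using this
    subst hτ
    have hv0 : v = 0 := by
      refine hnd v fun i => ?_
      have hi : HasFDerivAt (fun x : X => (H (0, x)).2 i)
          (((ContinuousLinearMap.proj i).comp (ContinuousLinearMap.snd ℝ ℝ (κ → ℝ))).comp
            ((fderiv ℝ H (0, p)).comp (ContinuousLinearMap.inr ℝ ℝ X))) p :=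
        ((ContinuousLinearMap.proj i).comp
          (ContinuousLinearMap.snd ℝ ℝ (κ → ℝ))).hasFDerivAt.comp p
          (hs.hasFDerivAt.comp p (ContinuousLinearMap.inr ℝ ℝ X).hasFDerivAt)
      have hi' : (fun x : X => (H (0, x)).2 i) = f i := by
        funext x; simp [H]
      rw [hi'] at hi
      rw [hi.fderiv]
      simp [hv']
    simp [hv0]
  have hsurj : LinearMap.range (fderiv ℝ H (0, p) : ℝ × X →ₗ[ℝ] ℝ × (κ → ℝ)) = ⊤ := by
    rw [LinearMap.range_eq_top, ← LinearMap.injective_iff_surjective_of_finrank_eq_finrank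
      (by simp [hκ])]
    exact LinearMap.ker_eq_bot.1 hinj
  have hmap := hs.map_nhds_eq_of_surj hsurj
  have hH0 : H (0, p) = (0, 0) := by simp only [H]; ext <;> simp [hp]
  have hBn : (Set.univ ×ˢ B : Set (ℝ × X)) ∈ nhds ((0 : ℝ), p) := prod_mem_nhds Filter.univ_mem hB
  have h1 : H '' (Set.univ ×ˢ B) ∈ nhds ((0 : ℝ), (0 : κ → ℝ)) := by
    rw [← hH0, ← hmap]; exact Filter.image_mem_map hBn
  have h2 : Filter.Tendsto (fun t : ℝ => (t, (0 : κ → ℝ))) (nhds 0) (nhds (0, 0)) :=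
    (Continuous.prodMk continuous_id continuous_const).tendsto 0
  filter_upwards [h2 h1] with t ht
  obtain ⟨⟨s, z⟩, ⟨-, hz⟩, hst⟩ := ht
  have hs : s = t := congrArg Prod.fst hst
  subst hs
  exact ⟨z, hz, fun i => congrFun (congrArg Prod.snd hst) i⟩

/-- A bihomogeneous Bezout bound for nondegenerate real zeros. -/
theorem card_nondegenerate_zeros_le (A : Fin m → ((Fin k → ℝ) × (Fin m → ℝ) → ℝ))
    (B : Fin k → ((Fin k → ℝ) × (Fin m → ℝ) → ℝ)) (d : Fin m → ℕ) (D : ℕ)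
    (hA : ∀ i, A i ∈ leftAffine k m ^ d i) (hB : ∀ l, B l ∈ leftAffine k m ^ D * rightAffine k m)
    (Z : Finset ((Fin k → ℝ) × (Fin m → ℝ))) (hZA : ∀ z ∈ Z, ∀ i, A i z = 0)
    (hZB : ∀ z ∈ Z, ∀ l, B l z = 0)
    (hnd : ∀ z ∈ Z, ∀ v, (∀ i, fderiv ℝ (A i) z v = 0) → (∀ l, fderiv ℝ (B l) z v = 0) → v = 0) :
    Z.card ≤ k.choose m * (∏ i, d i) * D ^ (k - m) := by
  classical
  let κ := Fin m ⊕ Fin k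
  let node : ℕ → ℝ := fun i => i
  let nodeI : Fin m → ℝ := fun i => -1 - (i : ℕ)
  let f : κ → ((Fin k → ℝ) × (Fin m → ℝ) → ℝ) := Sum.elim A B
  let g : κ → ((Fin k → ℝ) × (Fin m → ℝ) → ℝ) :=
    Sum.elim (fun i => vandermondeForm (leftCoord k m) (nodeI i) ^ d i)
      (fun l => vandermondeForm (leftCoord k m) (node l) ^ D *
        vandermondeForm (rightCoord k m) (node l))
  let dx : κ → ℕ := Sum.elim d fun _ => D
  let dy : κ → ℕ := Sum.elim (fun _ => 0) fun _ => 1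
  have hf : ∀ i, f i ∈ leftAffine k m ^ dx i * rightAffine k m ^ dy i := by
    rintro (i | l)
    · simpa [f, dx, dy] using hA i
    · simpa [f, dx, dy] using hB l
  have hL : ∀ t, vandermondeForm (leftCoord k m) t ∈ leftAffine k m :=
    vandermondeForm_mem_span _
  have hR : ∀ t, vandermondeForm (rightCoord k m) t ∈ rightAffine k m :=
    vandermondeForm_mem_span _
  have hg : ∀ i, g i ∈ leftAffine k m ^ dx i * rightAffine k m ^ dy i := by
    rintro (i | l)
    · simpa [g, dx, dy] using Submodule.pow_mem_pow _ (hL (nodeI i)) (d i)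
    · simpa [g, dx, dy] using Submodule.mul_mem_mul
        (Submodule.pow_mem_pow _ (hL (node l)) D) (hR (node l))
  have hcod := bidegCodimLE_special (leftCoord k m) (rightCoord k m) D node Nat.cast_injective
    Finset.univ nodeI (fun i j h => by simpa [nodeI, Fin.val_inj] using h)
    (fun i j h => by
      have h1 : (0 : ℝ) ≤ (i : ℝ) := Nat.cast_nonneg i
      have h2 : (0 : ℝ) ≤ ((j : ℕ) : ℝ) := Nat.cast_nonneg _
      simp only [node, nodeI] at h; linarith) d k 0 ∅ rfl (by simp; ring) (by simp) (by simp)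
  have hcod' : BidegCodimLE (leftAffine k m) (rightAffine k m)
      (Finset.univ.image fun i => (g i, dx i, dy i)) (k.choose m * (∏ i, d i) * D ^ (k - m)) := by
    refine BidegCodimLE.mono ?_ ?_ hcod
    · intro q hq
      simp only [vandermondeGens, Finset.image_empty, Finset.union_empty, Finset.empty_union,
        Finset.mem_union, Finset.mem_image, Finset.mem_range, Finset.mem_univ, true_and] at hq ⊢
      rcases hq with ⟨i, hi, rfl⟩ | ⟨i, rfl⟩
      · exact ⟨Sum.inr ⟨i, hi⟩, rfl⟩
      · exact ⟨Sum.inl i, rfl⟩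
    · simp only [zero_add, Finset.card_univ, Fintype.card_fin]
      split_ifs with h
      · rw [Nat.choose_symm h]
      · exact Nat.zero_le _
  obtain ⟨N, hN⟩ := hcod'
  let a := N + D + ∑ i, d i + Z.card
  let b := N + 1 + Z.card
  obtain ⟨E, hE1, hE2, hE3⟩ := hN a b (by omega) (by omega)
  refine le_trans ?_ hE2
  have hfin := finite_setOf_not_bidegIdeal_sup dx dy f g hf hg a b (by
    rintro (i | l)
    · have := Finset.single_le_sum (f := d) (fun _ _ => Nat.zero_le _) (Finset.mem_univ i)
      simp only [dx, Sum.elim_inl]; omega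
    · simp only [dx, Sum.elim_inr]; omega) (by
    rintro (i | l)
    · simp [dy]
    · simp only [dy, Sum.elim_inr]; omega) E hE3
  obtain ⟨O, hO, hdisj⟩ := Z.finite_toSet.t2_separation
  have hev : ∀ᶠ t : ℝ in nhds 0, ∀ z : Z, ∃ w ∈ O z, ∀ i, (f i + t • (g i - f i)) w = 0 := by
    rw [Filter.eventually_all]
    intro z
    refine eventually_exists_zero_homotopy (by simp [κ]; ring) f g
      (fun i => contDiff_of_mem_bidegree (hf i)) (fun i => contDiff_of_mem_bidegree (hg i)) z
      ?_ ?_ _ ((hO z).2.mem_nhds (hO z).1)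
    · rintro (i | l)
      · exact hZA z z.2 i
      · exact hZB z z.2 l
    · exact fun v hv => hnd z z.2 v (fun i => hv (Sum.inl i)) fun l => hv (Sum.inr l)
  obtain ⟨t, ht, htn⟩ : ∃ t : ℝ, (∀ z : Z, ∃ w ∈ O z, ∀ i, (f i + t • (g i - f i)) w = 0) ∧
      leftAffine k m ^ a * rightAffine k m ^ b ≤ bidegIdeal (leftAffine k m) (rightAffine k m)
      (Finset.univ.image fun i => (f i + t • (g i - f i), dx i, dy i)) a b ⊔ E := by
    have h1 : ∀ᶠ t : ℝ in nhdsWithin 0 {0}ᶜ, ∀ z : Z, ∃ w ∈ O z, ∀ i,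
        (f i + t • (g i - f i)) w = 0 := hev.filter_mono nhdsWithin_le_nhds
    have h2 := (hfin.subset Set.sdiff_subset (t := _ \ {(0 : ℝ)})).isClosed.isOpen_compl.mem_nhds
      (show (0 : ℝ) ∈ _ by simp)
    obtain ⟨t, h3, h4, h5⟩ := (h1.and ((Filter.Eventually.filter_mono nhdsWithin_le_nhds h2).and
      self_mem_nhdsWithin)).exists
    refine ⟨t, h3, ?_⟩
    by_contra h6
    exact h4 ⟨h6, h5⟩
  choose w hwO hw using ht
  have hwinj : Function.Injective w := by
    intro z z' h
    by_contra hne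
    exact Set.disjoint_left.1 (hdisj z.2 z'.2 fun h => hne (Subtype.ext h)) (hwO z) (h ▸ hwO z')
  let ev : ((Fin k → ℝ) × (Fin m → ℝ) → ℝ) →ₗ[ℝ] (Z → ℝ) := LinearMap.funLeft ℝ ℝ w
  have hsurj : ⊤ ≤ E.map ev := by
    have h1 : ⊤ ≤ (leftAffine k m ^ a * rightAffine k m ^ b).map ev := by
      rw [← (Pi.basisFun ℝ Z).span_eq, Submodule.span_le]
      rintro _ ⟨i, rfl⟩
      obtain ⟨q, hq, hq'⟩ := exists_mem_interpolating w hwinj a b (by simp; omega) (by simp; omega) i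
      refine ⟨q, hq, ?_⟩
      funext j
      simp [ev, LinearMap.funLeft_apply, hq', Pi.single_apply]
    refine h1.trans ((Submodule.map_mono htn).trans ?_)
    rw [Submodule.map_sup]
    refine sup_le ?_ le_rfl
    refine le_trans ?_ bot_le
    rw [Submodule.map_le_iff_le_comap]
    refine Finset.sup_le fun q hq => ?_
    obtain ⟨i, -, rfl⟩ := Finset.mem_image.1 hq
    rw [Submodule.mul_le]
    intro y hy x _
    obtain ⟨c, rfl⟩ := Submodule.mem_span_singleton.1 hy
    rw [Submodule.mem_comap, Submodule.mem_bot]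
    funext z
    have := hw z i
    simp only [ev, LinearMap.funLeft_apply, Pi.mul_apply, Pi.smul_apply, Pi.zero_apply, this,
      smul_zero, zero_mul]
  have h2 := Submodule.finrank_mono hsurj
  rw [finrank_top] at h2
  simpa using h2.trans (Submodule.finrank_map_le ev E)

end Bezout

lemma contDiff_eval_mvPolynomial {k : ℕ} (p : MvPolynomial (Fin k) ℝ) {n : WithTop ℕ∞} :
    ContDiff ℝ n fun x : Fin k → ℝ => eval x p := by
  induction p using MvPolynomial.induction_on with
  | C a => simpa using contDiff_const
  | add p q hp hq => simpa using hp.add hq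
  | mul_X p i hp => simpa using hp.mul (contDiff_apply ℝ ℝ i)

@[fun_prop]
lemma differentiable_eval_mvPolynomial {k : ℕ} (p : MvPolynomial (Fin k) ℝ) :
    Differentiable ℝ fun x : Fin k → ℝ => eval x p :=
  (contDiff_eval_mvPolynomial p (n := 1)).differentiable (by norm_num)

section Tilt

variable {k : ℕ} {J : Type*} [Fintype J]

/-- The family `p` perturbed by linear forms `b i`, in such a way that directional derivatives
along the directions `E` of a common function, with dual coordinates `Y`, stay of this form. -/
noncomputable def tilt (p : J → MvPolynomial (Fin k) ℝ) (E Y b : J → Fin k → ℝ) (i : J) :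
    MvPolynomial (Fin k) ℝ :=
  p i + ∑ r, C (b i r) * X r + ∑ l, C (b l ⬝ᵥ E i) * ∑ r, C (Y l r) * X r

variable (p : J → MvPolynomial (Fin k) ℝ) (E Y : J → Fin k → ℝ)

lemma eval_tilt (b : J → Fin k → ℝ) (i : J) (x : Fin k → ℝ) :
    eval x (tilt p E Y b i) = eval x (p i) + ∑ r, b i r * x r +
      ∑ l, (∑ r, b l r * E i r) * ∑ r, Y l r * x r := by
  simp [tilt, dotProduct]

lemma eval_pderiv_tilt (b : J → Fin k → ℝ) (i : J) (x : Fin k → ℝ) (r : Fin k) :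
    eval x (pderiv r (tilt p E Y b i)) = eval x (pderiv r (p i)) + b i r +
      ∑ l, (∑ r, b l r * E i r) * Y l r := by
  simp [tilt, dotProduct, pderiv_X, Pi.single_apply, eq_comm]

end Tilt

section NullSets

open MeasureTheory

lemma volume_image_eq_zero_of_fderiv_not_injective {X : Type*} [NormedAddCommGroup X]
    [NormedSpace ℝ X] [FiniteDimensional ℝ X] [MeasurableSpace X] [BorelSpace X] (μ : Measure X)
    [μ.IsAddHaarMeasure] (Ψ : X → X) (hΨ : Differentiable ℝ Ψ) (s : Set X)
    (hs : ∀ x ∈ s, ∃ w, w ≠ 0 ∧ fderiv ℝ Ψ x w = 0) : μ (Ψ '' s) = 0 := by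
  refine addHaar_image_eq_zero_of_det_fderivWithin_eq_zero μ
    (fun x _ => (hΨ x).hasFDerivAt.hasFDerivWithinAt) fun x hx => ?_
  obtain ⟨w, hw, hw'⟩ := hs x hx
  refine LinearMap.det_eq_zero_iff_ker_ne_bot.2 fun h => hw ?_
  exact (Submodule.eq_bot_iff _).1 h w hw'

lemma differentiable_extend {m : ℕ} {J : Type*} [Finite J]
    {X : Type*} [NormedAddCommGroup X] [NormedSpace ℝ X] (σ : Fin m → J) (hσ : Function.Injective σ)
    (f : X → Fin m → ℝ) (g : X → J → ℝ)
    (hf : ∀ t, Differentiable ℝ fun x => f x t) (hg : Differentiable ℝ g) :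
    Differentiable ℝ fun x => Function.extend σ (f x) (g x) := by
  have := Fintype.ofFinite J
  rw [differentiable_pi]
  intro i
  by_cases h : ∃ t, σ t = i
  · obtain ⟨t, rfl⟩ := h
    simpa only [hσ.extend_apply] using hf t
  · simp only [Function.extend_apply' _ _ _ h]
    exact differentiable_pi.1 hg i

variable {k m : ℕ} {J : Type*} [Fintype J]
  (p : J → MvPolynomial (Fin k) ℝ) (E Y : J → Fin k → ℝ)

/-- Parameters of the perturbation: levels, linear forms, and a linear objective. -/
abbrev TiltParam (k : ℕ) (J : Type*) := (J → ℝ) × (J → Fin k → ℝ) × (Fin k → ℝ)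

lemma measure_setOf_dependent_gradients [DecidableEq J] (μ : Measure (TiltParam k J))
    [μ.IsAddHaarMeasure] (σ : Fin m → J)
    (hσ : Function.Injective σ) (t₀ : Fin m)
    (hEY : Y (σ t₀) = 0 ∨ ∀ i, ∑ r, Y (σ t₀) r * E i r = if i = σ t₀ then 1 else 0) :
    μ {θ : TiltParam k J | ∃ (x : Fin k → ℝ) (c : Fin m → ℝ), c t₀ = 1 ∧
      (∀ t, eval x (tilt p E Y θ.2.1 (σ t)) = θ.1 (σ t)) ∧
      ∀ r, ∑ t, c t * eval x (pderiv r (tilt p E Y θ.2.1 (σ t))) = 0} = 0 := by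
  let co : TiltParam k J → Fin m → ℝ := fun θ t => if t = t₀ then 1 else θ.1 (σ t)
  let e : TiltParam k J → Fin k → ℝ := fun θ r => ∑ t, co θ t * E (σ t) r
  let R : TiltParam k J → Fin k → ℝ := fun θ r =>
    -(∑ t, co θ t * eval (θ.2.1 (σ t₀)) (pderiv r (p (σ t))) +
      ∑ t ∈ Finset.univ.erase t₀, co θ t * θ.2.1 (σ t) r +
      ∑ l ∈ Finset.univ.erase (σ t₀), (∑ q, θ.2.1 l q * e θ q) * Y l r)
  let β : TiltParam k J → Fin k → ℝ := fun θ r =>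
    R θ r - (1 / 2) * (∑ q, R θ q * e θ q) * Y (σ t₀) r
  let b : TiltParam k J → J → Fin k → ℝ := fun θ i => if i = σ t₀ then β θ else θ.2.1 i
  let Ψ : TiltParam k J → TiltParam k J := fun θ =>
    (Function.extend σ (fun t => eval (θ.2.1 (σ t₀)) (p (σ t)) +
      ∑ r, b θ (σ t) r * θ.2.1 (σ t₀) r +
      ∑ l, (∑ r, b θ l r * E (σ t) r) * ∑ r, Y l r * θ.2.1 (σ t₀) r) θ.1, b θ, θ.2.2)
  have hx : Differentiable ℝ fun θ : TiltParam k J => θ.2.1 (σ t₀) := by fun_prop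
  have hev : ∀ q : MvPolynomial (Fin k) ℝ,
      Differentiable ℝ fun θ : TiltParam k J => eval (θ.2.1 (σ t₀)) q :=
    fun q => (differentiable_eval_mvPolynomial q).comp hx
  have hco : ∀ t, Differentiable ℝ fun θ => co θ t := by
    intro t
    simp only [co]
    split_ifs <;> fun_prop
  have he : ∀ r, Differentiable ℝ fun θ => e θ r := by
    intro r; simp only [e]; fun_prop
  have hR : ∀ r, Differentiable ℝ fun θ => R θ r := by
    intro r; simp only [R]; fun_prop
  have hβ : ∀ r, Differentiable ℝ fun θ => β θ r := by
    intro r; simp only [β]; fun_prop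
  have hb : ∀ i r, Differentiable ℝ fun θ => b θ i r := by
    intro i r
    simp only [b]
    split_ifs
    · exact hβ r
    · fun_prop
  have hb' : Differentiable ℝ b := by
    rw [differentiable_pi]; intro i; rw [differentiable_pi]; exact hb i
  have hΨ : Differentiable ℝ Ψ := by
    refine (differentiable_extend σ hσ _ _ (fun t => ?_) (by fun_prop)).prodMk
      (hb'.prodMk (by fun_prop))
    fun_prop
  refine measure_mono_null ?_ (volume_image_eq_zero_of_fderiv_not_injective μ Ψ hΨ Set.univ ?_)
  · rintro ⟨v, b₀, a⟩ ⟨x, c, hc, hG, hgrad⟩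
    let θ : TiltParam k J := (Function.extend σ c v, Function.update b₀ (σ t₀) x, a)
    have hx0 : θ.2.1 (σ t₀) = x := by simp [θ]
    have hcoθ : co θ = c := by
      funext t
      simp only [co, θ, hσ.extend_apply]
      split_ifs with h
      · rw [h, hc]
      · rfl
    have hbne : ∀ i, i ≠ σ t₀ → θ.2.1 i = b₀ i := fun i hi => by simp [θ, hi]
    have hRθ : ∀ r, R θ r = b₀ (σ t₀) r + (∑ q, b₀ (σ t₀) q * e θ q) * Y (σ t₀) r := by
      intro r
      have h1 := hgrad r
      simp only [eval_pderiv_tilt, mul_add, Finset.sum_add_distrib] at h1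
      have h2 : ∑ t, c t * ∑ l, (∑ q, b₀ l q * E (σ t) q) * Y l r =
          ∑ l, (∑ q, b₀ l q * e θ q) * Y l r := by
        simp only [Finset.mul_sum, Finset.sum_mul, e, hcoθ]
        rw [Finset.sum_comm]
        refine Finset.sum_congr rfl fun l _ => ?_
        rw [Finset.sum_comm]
        refine Finset.sum_congr rfl fun q _ => Finset.sum_congr rfl fun t _ => by ring
      rw [h2, ← Finset.add_sum_erase _ _ (Finset.mem_univ (σ t₀)),
        ← Finset.add_sum_erase _ (fun t => c t * b₀ (σ t) r) (Finset.mem_univ t₀), hc] at h1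
      have h3 : ∑ t ∈ Finset.univ.erase t₀, c t * θ.2.1 (σ t) r =
          ∑ t ∈ Finset.univ.erase t₀, c t * b₀ (σ t) r :=
        Finset.sum_congr rfl fun t ht => by
          rw [hbne _ (hσ.ne (Finset.ne_of_mem_erase ht))]
      have h4 : ∑ l ∈ Finset.univ.erase (σ t₀), (∑ q, θ.2.1 l q * e θ q) * Y l r =
          ∑ l ∈ Finset.univ.erase (σ t₀), (∑ q, b₀ l q * e θ q) * Y l r :=
        Finset.sum_congr rfl fun l hl => by rw [hbne _ (Finset.ne_of_mem_erase hl)]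
      simp only [R, hx0, hcoθ, h3, h4]
      linarith
    have hβθ : β θ = b₀ (σ t₀) := by
      funext r
      simp only [β]
      rcases hEY with h0 | h1
      · simp [hRθ, h0]
      · have hYe : ∑ q, Y (σ t₀) q * e θ q = 1 := by
          simp only [e, hcoθ, Finset.mul_sum]
          rw [Finset.sum_comm]
          have : ∀ t, ∑ q, Y (σ t₀) q * (c t * E (σ t) q) = c t * (if t = t₀ then 1 else 0) := by
            intro t
            have h2 := h1 (σ t)
            rw [show (if σ t = σ t₀ then (1 : ℝ) else 0) = if t = t₀ then 1 else 0 by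
              simp [hσ.eq_iff]] at h2
            rw [← h2, Finset.mul_sum]
            exact Finset.sum_congr rfl fun q _ => by ring
          simp [this, hc]
        have hRe : ∑ q, R θ q * e θ q = 2 * ∑ q, b₀ (σ t₀) q * e θ q := by
          simp only [hRθ, add_mul, Finset.sum_add_distrib]
          simp only [mul_assoc, ← Finset.mul_sum, hYe]
          ring
        rw [hRe, hRθ]; ring
    have hbθ : b θ = b₀ := by
      funext i
      simp only [b]
      split_ifs with h
      · rw [h, hβθ]
      · exact hbne i h
    refine ⟨θ, Set.mem_univ _, ?_⟩
    simp only [Ψ, hbθ, hx0]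
    refine Prod.ext ?_ rfl
    funext i
    by_cases h : ∃ t, σ t = i
    · obtain ⟨t, rfl⟩ := h
      simp only [hσ.extend_apply]
      exact (eval_tilt p E Y b₀ (σ t) x).symm.trans (hG t)
    · simp only [Function.extend_apply' _ _ _ h, θ]
  · intro θ _
    let w : TiltParam k J := (Pi.single (σ t₀) 1, 0, 0)
    refine ⟨w, fun h => ?_, ?_⟩
    · have := congrFun (congrArg Prod.fst h) (σ t₀)
      simp [w] at this
    · have hinv : ∀ t : ℝ, Ψ (θ + t • w) = Ψ θ := by
        intro t
        have h2 : (θ + t • w).2 = θ.2 := by simp [w]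
        have h1 : ∀ i, i ≠ σ t₀ → (θ + t • w).1 i = θ.1 i := fun i hi => by simp [w, hi]
        have hco' : co (θ + t • w) = co θ := by
          funext s
          simp only [co]
          split_ifs with h
          · rfl
          · exact h1 _ (hσ.ne h)
        have he' : e (θ + t • w) = e θ := by simp only [e, hco']
        have hR' : R (θ + t • w) = R θ := by simp only [R, hco', he', h2]
        have hb' : b (θ + t • w) = b θ := by simp only [b, β, hR', he', h2]
        simp only [Ψ, hb', h2]
        refine Prod.ext ?_ rfl
        funext i
        by_cases h : ∃ s, σ s = i
        · obtain ⟨s, rfl⟩ := h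
          simp only [hσ.extend_apply]
        · simp only [Function.extend_apply' _ _ _ h]
          exact h1 _ fun hi => h ⟨t₀, hi.symm⟩
      have hd := (hΨ θ).hasFDerivAt.hasLineDerivAt w
      rw [HasLineDerivAt] at hd
      simp only [hinv] at hd
      exact hd.unique (hasDerivAt_const _ _)

lemma measure_setOf_degenerate_critical_points (μ : Measure (TiltParam k J))
    [μ.IsAddHaarMeasure] (g : MvPolynomial (Fin k) ℝ) (σ : Fin m → J)
    (hσ : Function.Injective σ) :
    μ {θ : TiltParam k J | ∃ z w : (Fin k → ℝ) × (Fin m → ℝ), w ≠ 0 ∧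
      (∀ t, eval z.1 (tilt p E Y θ.2.1 (σ t)) - θ.1 (σ t) = 0) ∧
      (∀ l, eval z.1 (pderiv l g) - θ.2.2 l -
        ∑ t, z.2 t * eval z.1 (pderiv l (tilt p E Y θ.2.1 (σ t))) = 0) ∧
      (∀ t, fderiv ℝ (fun z : (Fin k → ℝ) × (Fin m → ℝ) =>
        eval z.1 (tilt p E Y θ.2.1 (σ t)) - θ.1 (σ t)) z w = 0) ∧
      ∀ l, fderiv ℝ (fun z : (Fin k → ℝ) × (Fin m → ℝ) =>
        eval z.1 (pderiv l g) - θ.2.2 l -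
        ∑ t, z.2 t * eval z.1 (pderiv l (tilt p E Y θ.2.1 (σ t)))) z w = 0} = 0 := by
  let Ψ : TiltParam k J → TiltParam k J := fun θ =>
    (Function.extend σ (fun t => eval θ.2.2 (tilt p E Y θ.2.1 (σ t))) θ.1, θ.2.1,
      fun l => eval θ.2.2 (pderiv l g) -
        ∑ t, θ.1 (σ t) * eval θ.2.2 (pderiv l (tilt p E Y θ.2.1 (σ t))))
  have hev : ∀ q : MvPolynomial (Fin k) ℝ,
      Differentiable ℝ fun θ : TiltParam k J => eval θ.2.2 q :=
    fun q => (differentiable_eval_mvPolynomial q).comp (by fun_prop)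
  have hΨ : Differentiable ℝ Ψ := by
    refine (differentiable_extend σ hσ _ _ (fun t => ?_) (by fun_prop)).prodMk
      (Differentiable.prodMk (by fun_prop) ?_)
    · simp only [eval_tilt]; fun_prop
    · rw [differentiable_pi]
      intro l
      simp only [eval_pderiv_tilt]; fun_prop
  let s : Set (TiltParam k J) := {θ | ∃ w, w ≠ 0 ∧ fderiv ℝ Ψ θ w = 0}
  refine measure_mono_null ?_
    (volume_image_eq_zero_of_fderiv_not_injective μ Ψ hΨ s fun θ hθ => hθ)
  rintro ⟨v, b, a⟩ ⟨z, w, hw, hA, hB, hA', hB'⟩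
  let j : (Fin k → ℝ) × (Fin m → ℝ) → TiltParam k J := fun z => (Function.extend σ z.2 v, b, z.1)
  have hjd : Differentiable ℝ j :=
    (differentiable_extend σ hσ _ _ (fun t => by fun_prop) (by fun_prop)).prodMk
      (Differentiable.prodMk (by fun_prop) (by fun_prop))
  have hΨj : ∀ z, Ψ (j z) = (Function.extend σ (fun t => eval z.1 (tilt p E Y b (σ t))) v, b,
      fun l => eval z.1 (pderiv l g) -
        ∑ t, z.2 t * eval z.1 (pderiv l (tilt p E Y b (σ t)))) := by
    intro z
    simp only [Ψ, j, hσ.extend_apply]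
    refine Prod.ext ?_ rfl
    funext i
    by_cases h : ∃ t, σ t = i
    · obtain ⟨t, rfl⟩ := h
      simp only [hσ.extend_apply]
    · simp only [Function.extend_apply' _ _ _ h]
  refine ⟨j z, ⟨fderiv ℝ j z w, ?_, ?_⟩, ?_⟩
  · intro h0
    have hz : HasFDerivAt (fun z => ((j z).2.2, fun t => (j z).1 (σ t))) (ContinuousLinearMap.id ℝ
        ((Fin k → ℝ) × (Fin m → ℝ))) z := by
      simp only [j, hσ.extend_apply]
      exact hasFDerivAt_id z
    let L : TiltParam k J →L[ℝ] (Fin k → ℝ) × (Fin m → ℝ) :=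
      ((ContinuousLinearMap.snd ℝ _ _).comp (ContinuousLinearMap.snd ℝ _ _)).prod
        (ContinuousLinearMap.pi fun t =>
          (ContinuousLinearMap.proj (σ t)).comp (ContinuousLinearMap.fst ℝ _ _))
    have hz' := L.hasFDerivAt.comp z (hjd z).hasFDerivAt
    have h1 := DFunLike.congr_fun (hz.unique hz') w
    apply hw
    simpa [h0] using h1
  · have hc := ((hΨ (j z)).hasFDerivAt.comp z (hjd z).hasFDerivAt)
    have hgoal : fderiv ℝ (Ψ ∘ j) z w = 0 := by
      have hcomp : Ψ ∘ j = fun z => (Function.extend σ (fun t => eval z.1 (tilt p E Y b (σ t))) v,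
          b, fun l => eval z.1 (pderiv l g) -
            ∑ t, z.2 t * eval z.1 (pderiv l (tilt p E Y b (σ t)))) := funext hΨj
      have hdiff : DifferentiableAt ℝ (Ψ ∘ j) z := (hΨ.comp hjd) z
      have hpr : ∀ L : TiltParam k J →L[ℝ] ℝ,
          L (fderiv ℝ (Ψ ∘ j) z w) = fderiv ℝ (fun z => L ((Ψ ∘ j) z)) z w := by
        intro L
        have := (L.hasFDerivAt.comp z hdiff.hasFDerivAt).fderiv
        exact (DFunLike.congr_fun this w).symm
      refine Prod.ext (funext fun i => ?_) (Prod.ext (funext fun i => funext fun r => ?_)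
        (funext fun l => ?_))
      · refine (hpr ((ContinuousLinearMap.proj i).comp (ContinuousLinearMap.fst ℝ _ _))).trans ?_
        rw [hcomp]
        by_cases h : ∃ t, σ t = i
        · obtain ⟨t, rfl⟩ := h
          have h2 := hA' t
          rw [fderiv_sub_const] at h2
          simpa [hσ.extend_apply] using h2
        · simp [Function.extend_apply' _ _ _ h]
      · refine (hpr ((ContinuousLinearMap.proj (φ := fun _ : Fin k => ℝ) r).comp
          ((ContinuousLinearMap.proj (φ := fun _ : J => Fin k → ℝ) i).comp ((ContinuousLinearMap.fst ℝ _ _).comp (ContinuousLinearMap.snd ℝ _ _))))).trans ?_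
        rw [hcomp]
        simp
      · refine (hpr ((ContinuousLinearMap.proj l).comp
          ((ContinuousLinearMap.snd ℝ _ _).comp (ContinuousLinearMap.snd ℝ _ _)))).trans ?_
        rw [hcomp]
        have h2 := hB' l
        simp only [sub_right_comm _ (a l)] at h2
        rw [fderiv_sub_const] at h2
        exact h2
    rw [hc.fderiv] at hgoal
    exact hgoal
  · rw [hΨj]
    refine Prod.ext (funext fun i => ?_) (Prod.ext rfl (funext fun l => ?_))
    · by_cases h : ∃ t, σ t = i
      · obtain ⟨t, rfl⟩ := h
        simp only [hσ.extend_apply]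
        exact sub_eq_zero.1 (hA t)
      · simp only [Function.extend_apply' _ _ _ h]
    · have := hB l
      simp only at this ⊢
      linarith

end NullSets

section Slicing

open MeasureTheory

lemma measure_eq_zero_of_dimH_lt_finrank {X : Type*} [NormedAddCommGroup X] [NormedSpace ℝ X]
    [FiniteDimensional ℝ X] [MeasurableSpace X] [BorelSpace X] (μ : Measure X)
    [μ.IsAddHaarMeasure] {s : Set X} (hs : dimH s < Module.finrank ℝ X) : μ s = 0 := by
  have h : μH[((Module.finrank ℝ X : NNReal) : ℝ)] s = 0 :=
    hausdorffMeasure_of_dimH_lt (by simpa using hs)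
  have := isAddHaarMeasure_hausdorffMeasure (E := X)
  have h2 : μ ≪ μH[(Module.finrank ℝ X : ℝ)] := Measure.absolutelyContinuous_isAddHaarMeasure _ _
  exact h2 (by simpa using h)

variable {k' c : ℕ}

lemma natAdd_sum_append (t : Fin c → Fin k' → ℝ) (y : Fin c → ℝ) (j : Fin c) :
    (∑ l, y l • Fin.append (t l) (Pi.single l (1 : ℝ))) (Fin.natAdd k' j) = y j := by
  simp [Finset.sum_apply, Pi.single_apply]

lemma castAdd_sum_append (t : Fin c → Fin k' → ℝ) (y : Fin c → ℝ) (j : Fin k') :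
    (∑ l, y l • Fin.append (t l) (Pi.single l (1 : ℝ))) (Fin.castAdd c j) = ∑ l, y l * t l j := by
  simp [Finset.sum_apply]

lemma dimH_slope_image_le (Z : Set (Fin (k' + c) → ℝ)) (z : Fin (k' + c) → ℝ) (i₀ : Fin c)
    (t : Fin c → Fin k' → ℝ) :
    dimH ((fun x : Fin (k' + c) → ℝ => ((fun j : Fin k' => (x (Fin.natAdd k' i₀) -
        z (Fin.natAdd k' i₀))⁻¹ * (x (Fin.castAdd c j) - z (Fin.castAdd c j) -
        ∑ l ∈ Finset.univ.erase i₀, (x (Fin.natAdd k' l) - z (Fin.natAdd k' l)) * t l j)),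
        ‖fun l : Fin c => x (Fin.natAdd k' l) - z (Fin.natAdd k' l)‖)) ''
      (Z ∩ {x | x (Fin.natAdd k' i₀) - z (Fin.natAdd k' i₀) ≠ 0})) ≤ dimH Z := by
  refine (dimH_image_le_of_locally_lipschitzOn fun x hx => ?_).trans
    (dimH_mono Set.inter_subset_left)
  have h1 : ContDiffAt ℝ 1 (fun x : Fin (k' + c) → ℝ => fun j : Fin k' =>
      (x (Fin.natAdd k' i₀) - z (Fin.natAdd k' i₀))⁻¹ *
        (x (Fin.castAdd c j) - z (Fin.castAdd c j) -
        ∑ l ∈ Finset.univ.erase i₀, (x (Fin.natAdd k' l) - z (Fin.natAdd k' l)) * t l j)) x := by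
    rw [contDiffAt_pi]
    intro j
    refine ContDiffAt.mul (ContDiffAt.inv (by fun_prop) hx.2) (by fun_prop)
  have h2 : ContDiffAt ℝ 1 (fun x : Fin (k' + c) → ℝ => fun l : Fin c =>
      x (Fin.natAdd k' l) - z (Fin.natAdd k' l)) x := by fun_prop
  obtain ⟨K, s, hs, hK⟩ := h1.exists_lipschitzOnWith
  obtain ⟨K', s', hs', hK'⟩ := h2.exists_lipschitzOnWith
  refine ⟨_, s ∩ s', mem_nhdsWithin_of_mem_nhds (Filter.inter_mem hs hs'),
    (hK.mono Set.inter_subset_left).prodMk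
      ((lipschitzWith_one_norm.comp_lipschitzOnWith hK').mono Set.inter_subset_right)⟩

lemma exists_slopes_null_radii (Z : Set (Fin (k' + c) → ℝ)) (hZ : dimH Z ≤ (k' : ℝ≥0∞))
    (F : Set (Fin (k' + c) → ℝ)) (hF : F.Finite) (n : ℕ) (hn : n ≤ c) :
    ∃ t : Fin c → Fin k' → ℝ, ∀ z ∈ F, volume {r : ℝ | ∃ y : Fin c → ℝ,
      (∀ i : Fin c, n ≤ i → y i = 0) ∧ y ≠ 0 ∧ ‖y‖ = r ∧
      z + ∑ l, y l • Fin.append (t l) (Pi.single l (1 : ℝ)) ∈ Z} = 0 := by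
  induction n with
  | zero =>
    refine ⟨0, fun z _ => ?_⟩
    convert measure_empty (μ := (volume : Measure ℝ)) using 2
    rw [Set.eq_empty_iff_forall_notMem]
    rintro r ⟨y, h1, h2, -⟩
    exact h2 (funext fun i => h1 i (Nat.zero_le _))
  | succ n ih =>
    obtain ⟨t, ht⟩ := ih (by omega)
    let i₀ : Fin c := ⟨n, by omega⟩
    let g : (Fin (k' + c) → ℝ) → (Fin (k' + c) → ℝ) → (Fin k' → ℝ) × ℝ := fun z x =>
      ((fun j : Fin k' => (x (Fin.natAdd k' i₀) -
        z (Fin.natAdd k' i₀))⁻¹ * (x (Fin.castAdd c j) - z (Fin.castAdd c j) -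
        ∑ l ∈ Finset.univ.erase i₀, (x (Fin.natAdd k' l) - z (Fin.natAdd k' l)) * t l j)),
        ‖fun l : Fin c => x (Fin.natAdd k' l) - z (Fin.natAdd k' l)‖)
    let I : (Fin (k' + c) → ℝ) → Set ((Fin k' → ℝ) × ℝ) := fun z =>
      g z '' (Z ∩ {x | x (Fin.natAdd k' i₀) - z (Fin.natAdd k' i₀) ≠ 0})
    have hI : ∀ z, ((volume : Measure (Fin k' → ℝ)).prod (volume : Measure ℝ)) (I z) = 0 := by
      intro z
      refine measure_eq_zero_of_dimH_lt_finrank _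
        (lt_of_le_of_lt ((dimH_slope_image_le Z z i₀ t).trans hZ) ?_)
      simp only [Module.finrank_prod, Module.finrank_fin_fun, Module.finrank_self]
      exact_mod_cast Nat.lt_succ_self k'
    have hae : ∀ᵐ τ : Fin k' → ℝ, ∀ z ∈ F, volume (Prod.mk τ ⁻¹' I z) = 0 := by
      rw [ae_ball_iff hF.countable]
      exact fun z _ => Measure.measure_ae_null_of_prod_null (hI z)
    obtain ⟨τ, hτ⟩ := hae.exists
    refine ⟨Function.update t i₀ τ, fun z hz => ?_⟩
    refine measure_mono_null ?_ (measure_union_null (ht z hz) (hτ z hz))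
    rintro r ⟨y, h1, h2, h3, h4⟩
    by_cases hy : y i₀ = 0
    · refine Or.inl ⟨y, fun i hi => ?_, h2, h3, ?_⟩
      · rcases hi.eq_or_lt with h | h
        · have : i = i₀ := Fin.ext h.symm
          rw [this, hy]
        · exact h1 i h
      · have h5 : ∀ l, y l • Fin.append (Function.update t i₀ τ l) (Pi.single l (1 : ℝ)) =
            y l • Fin.append (t l) (Pi.single l 1) := by
          intro l
          by_cases hl : l = i₀
          · rw [hl, hy, zero_smul, zero_smul]
          · rw [Function.update_of_ne hl]
        simpa only [h5] using h4
    · refine Or.inr ⟨_, ⟨h4, ?_⟩, ?_⟩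
      · simpa only [Set.mem_ofPred_eq, Pi.add_apply, natAdd_sum_append, add_sub_cancel_left] using hy
      · simp only [g, Pi.add_apply, natAdd_sum_append, castAdd_sum_append, add_sub_cancel_left]
        refine Prod.ext (funext fun j => ?_) h3
        change (y i₀)⁻¹ * (∑ l, y l * Function.update t i₀ τ l j -
          ∑ l ∈ Finset.univ.erase i₀, y l * t l j) = τ j
        rw [← Finset.add_sum_erase _ (fun l => y l * Function.update t i₀ τ l j)
          (Finset.mem_univ i₀)]
        have : ∑ l ∈ Finset.univ.erase i₀, y l * Function.update t i₀ τ l j =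
            ∑ l ∈ Finset.univ.erase i₀, y l * t l j :=
          Finset.sum_congr rfl fun l hl => by
            rw [Function.update_of_ne (Finset.ne_of_mem_erase hl)]
        simp only [this, add_sub_cancel_right, Function.update_self]
        field_simp

/-- Generic complementary directions have spheres of small radius around finitely many given points
that avoid a set of small Hausdorff dimension. -/
lemma exists_directions_avoiding (Z : Set (Fin (k' + c) → ℝ)) (hZ : dimH Z ≤ (k' : ℝ≥0∞))
    (F : Set (Fin (k' + c) → ℝ)) (hF : F.Finite) :
    ∃ E : Fin c → Fin (k' + c) → ℝ,
      (∀ l j, E l (Fin.natAdd k' j) = if j = l then 1 else 0) ∧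
      ∀ z ∈ F, ∀ r₀ > 0, ∃ r, 0 < r ∧ r < r₀ ∧
        ∀ y : Fin c → ℝ, ‖y‖ = r → z + ∑ l, y l • E l ∉ Z := by
  obtain ⟨t, ht⟩ := exists_slopes_null_radii Z hZ F hF c le_rfl
  refine ⟨fun l => Fin.append (t l) (Pi.single l 1), fun l j => by simp [Pi.single_apply], ?_⟩
  intro z hz r₀ hr₀
  by_contra! h
  have hsub : Set.Ioo 0 r₀ ⊆ {r : ℝ | ∃ y : Fin c → ℝ,
      (∀ i : Fin c, c ≤ i → y i = 0) ∧ y ≠ 0 ∧ ‖y‖ = r ∧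
      z + ∑ l, y l • Fin.append (t l) (Pi.single l (1 : ℝ)) ∈ Z} := by
    intro r hr
    obtain ⟨y, hy, hyZ⟩ := h r hr.1 hr.2
    refine ⟨y, fun i hi => absurd i.2 (not_lt.2 hi), ?_, hy, hyZ⟩
    rintro rfl
    exact hr.1.ne (by simpa using hy)
  have := measure_mono_null hsub (ht z hz)
  rw [Real.volume_Ioo, ENNReal.ofReal_eq_zero] at this
  linarith

end Slicing

lemma totalDegree_pderiv_le {k : ℕ} (p : MvPolynomial (Fin k) ℝ) (r : Fin k) :
    (pderiv r p).totalDegree ≤ p.totalDegree - 1 := by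
  conv_lhs => rw [p.as_sum, map_sum]
  refine totalDegree_finsetSum_le fun s hs => ?_
  rw [pderiv_monomial]
  by_cases h : s r = 0
  · simp [h]
  refine (totalDegree_monomial_le _ _).trans ?_
  have h1 := le_totalDegree hs
  have h2 : s - Finsupp.single r 1 + Finsupp.single r 1 = s :=
    tsub_add_cancel_of_le (Finsupp.single_le_iff.2 (Nat.one_le_iff_ne_zero.2 h))
  have h3 : (s - Finsupp.single r 1).sum (fun _ e => e) + 1 = s.sum fun _ e => e := by
    conv_rhs => rw [← h2]
    rw [Finsupp.sum_add_index' (by simp) (by simp), Finsupp.sum_single_index rfl]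
  change (s - Finsupp.single r 1).sum (fun _ e => e) ≤ _
  omega

lemma eval_fst_mem_leftAffine_pow {k m : ℕ} (p : MvPolynomial (Fin k) ℝ) {n : ℕ}
    (hp : p.totalDegree ≤ n) :
    (fun z : (Fin k → ℝ) × (Fin m → ℝ) => eval z.1 p) ∈ leftAffine k m ^ n := by
  have h1 : (1 : Submodule ℝ ((Fin k → ℝ) × (Fin m → ℝ) → ℝ)) ≤ leftAffine k m :=
    Submodule.one_le.2 one_mem_leftAffine
  have h2 : (fun z : (Fin k → ℝ) × (Fin m → ℝ) => eval z.1 p) =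
      ∑ s ∈ p.support, coeff s p • ∏ r, (fun z : (Fin k → ℝ) × (Fin m → ℝ) => z.1 r) ^ s r := by
    funext z
    simp [eval_eq', Finset.sum_apply, Finset.prod_apply]
  rw [h2]
  refine Submodule.sum_mem _ fun s hs => Submodule.smul_mem _ _ ?_
  have h3 : ∑ r, s r ≤ n := by
    have := le_totalDegree hs
    rw [Finsupp.sum_fintype _ _ (fun _ => rfl)] at this
    omega
  refine pow_le_pow_right' h1 h3 ?_
  have h4 : ∀ S : Finset (Fin k), ∏ r ∈ S, (fun z : (Fin k → ℝ) × (Fin m → ℝ) => z.1 r) ^ s r ∈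
      leftAffine k m ^ ∑ r ∈ S, s r := by
    intro S
    classical
    induction S using Finset.induction_on with
    | empty => simp [Submodule.one_le.1 le_rfl]
    | insert r S hr ih =>
      rw [Finset.prod_insert hr, Finset.sum_insert hr, pow_add]
      exact Submodule.mul_mem_mul (Submodule.pow_mem_pow _ (fst_mem_leftAffine r) _) ih
  exact h4 _

section Critical

variable {k m : ℕ}

/-- Lagrange equations have at most the multihomogeneous Bézout number of solutions. -/
lemma card_critical_points_le (g : MvPolynomial (Fin k) ℝ) (q : Fin m → MvPolynomial (Fin k) ℝ)
    (v : Fin m → ℝ) (a : Fin k → ℝ) (e : Fin m → ℕ) (D : ℕ)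
    (hq : ∀ t, (q t).totalDegree ≤ e t) (hqD : ∀ t, (q t).totalDegree ≤ D)
    (hg : g.totalDegree ≤ D) (F : Finset (Fin k → ℝ))
    (hF : ∀ x ∈ F, ∃ y : Fin m → ℝ, (∀ t, eval x (q t) = v t) ∧
      ∀ l, eval x (pderiv l g) - a l - ∑ t, y t * eval x (pderiv l (q t)) = 0)
    (hnd : ∀ z w : (Fin k → ℝ) × (Fin m → ℝ),
      (∀ t, eval z.1 (q t) - v t = 0) →
      (∀ l, eval z.1 (pderiv l g) - a l - ∑ t, z.2 t * eval z.1 (pderiv l (q t)) = 0) →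
      (∀ t, fderiv ℝ (fun z : (Fin k → ℝ) × (Fin m → ℝ) => eval z.1 (q t) - v t) z w = 0) →
      (∀ l, fderiv ℝ (fun z : (Fin k → ℝ) × (Fin m → ℝ) =>
        eval z.1 (pderiv l g) - a l - ∑ t, z.2 t * eval z.1 (pderiv l (q t))) z w = 0) → w = 0) :
    F.card ≤ k.choose m * (∏ t, e t) * D ^ (k - m) := by
  classical
  choose! y hy using hF
  have h1 : (1 : Submodule ℝ ((Fin k → ℝ) × (Fin m → ℝ) → ℝ)) ≤ leftAffine k m :=
    Submodule.one_le.2 one_mem_leftAffine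
  have hconst : ∀ (r : ℝ) (n : ℕ),
      (fun _ : (Fin k → ℝ) × (Fin m → ℝ) => r) ∈ leftAffine k m ^ n := by
    intro r n
    simpa using eval_fst_mem_leftAffine_pow (m := m) (C r : MvPolynomial (Fin k) ℝ) (n := n)
      (by simp)
  have hleft : ∀ f ∈ leftAffine k m ^ D, f ∈ leftAffine k m ^ D * rightAffine k m := by
    intro f hf
    simpa using Submodule.mul_mem_mul hf (one_mem_rightAffine (k := k) (m := m))
  have hD : ∀ p : MvPolynomial (Fin k) ℝ, p.totalDegree ≤ D → ∀ l,
      (fun z : (Fin k → ℝ) × (Fin m → ℝ) => eval z.1 (pderiv l p)) ∈ leftAffine k m ^ D :=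
    fun p hp l => eval_fst_mem_leftAffine_pow _
      ((totalDegree_pderiv_le p l).trans (Nat.sub_le _ _ |>.trans hp))
  have hA : ∀ t, (fun z : (Fin k → ℝ) × (Fin m → ℝ) => eval z.1 (q t) - v t) ∈
      leftAffine k m ^ e t :=
    fun t => Submodule.sub_mem _ (eval_fst_mem_leftAffine_pow _ (hq t)) (hconst _ _)
  have hB : ∀ l, (fun z : (Fin k → ℝ) × (Fin m → ℝ) =>
      eval z.1 (pderiv l g) - a l - ∑ t, z.2 t * eval z.1 (pderiv l (q t))) ∈
      leftAffine k m ^ D * rightAffine k m := by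
    intro l
    have h2 : (fun z : (Fin k → ℝ) × (Fin m → ℝ) =>
        eval z.1 (pderiv l g) - a l - ∑ t, z.2 t * eval z.1 (pderiv l (q t))) =
        (fun z : (Fin k → ℝ) × (Fin m → ℝ) => eval z.1 (pderiv l g)) - (fun _ => a l) -
        ∑ t, (fun z : (Fin k → ℝ) × (Fin m → ℝ) => eval z.1 (pderiv l (q t))) *
          fun z => z.2 t := by
      funext z
      simp [Finset.sum_apply, mul_comm]
    rw [h2]
    exact Submodule.sub_mem _ (Submodule.sub_mem _ (hleft _ (hD g hg l)) (hleft _ (hconst _ _)))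
      (Submodule.sum_mem _ fun t _ =>
        Submodule.mul_mem_mul (hD _ (hqD t) l) (snd_mem_rightAffine t))
  have hinj : Function.Injective fun x => (x, y x) := fun x x' h => congrArg Prod.fst h
  have hZ : ∀ z ∈ F.map ⟨_, hinj⟩, z.1 ∈ F ∧ z.2 = y z.1 := by
    intro z hz
    obtain ⟨x, hx, rfl⟩ := Finset.mem_map.1 hz
    exact ⟨hx, rfl⟩
  have hZA : ∀ z ∈ F.map ⟨_, hinj⟩, ∀ t, eval z.1 (q t) - v t = 0 :=
    fun z hz t => sub_eq_zero.2 ((hy _ (hZ z hz).1).1 t)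
  have hZB : ∀ z ∈ F.map ⟨_, hinj⟩, ∀ l,
      eval z.1 (pderiv l g) - a l - ∑ t, z.2 t * eval z.1 (pderiv l (q t)) = 0 := by
    intro z hz l
    rw [(hZ z hz).2]
    exact (hy _ (hZ z hz).1).2 l
  rw [← Finset.card_map ⟨_, hinj⟩]
  exact card_nondegenerate_zeros_le _ _ e D hA hB _ hZA hZB
    fun z hz w => hnd z w (hZA z hz) (hZB z hz)

lemma hasStrictFDerivAt_eval (p : MvPolynomial (Fin k) ℝ) (x : Fin k → ℝ) :
    HasStrictFDerivAt (fun x : Fin k → ℝ => eval x p)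
      (∑ r, eval x (pderiv r p) • (ContinuousLinearMap.proj r : (Fin k → ℝ) →L[ℝ] ℝ)) x := by
  induction p using MvPolynomial.induction_on with
  | C a => simpa using hasStrictFDerivAt_const a x
  | add p q hp hq =>
    simp only [map_add]
    exact (hp.add hq).congr_fderiv (by simp only [add_smul, Finset.sum_add_distrib])
  | mul_X p i hp =>
    have h := hp.mul ((ContinuousLinearMap.proj (R := ℝ) (φ := fun _ : Fin k => ℝ)
      i).hasStrictFDerivAt (x := x))
    simp only [map_mul, eval_X]
    refine h.congr_fderiv ?_
    ext w
    simp [pderiv_X, Pi.single_apply, add_mul, Finset.sum_add_distrib, Finset.mul_sum, apply_ite,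
      mul_assoc]

lemma exists_multipliers_of_isLocalMinOn (g : MvPolynomial (Fin k) ℝ) {T : Type*} [Fintype T]
    (q : T → MvPolynomial (Fin k) ℝ) (v : T → ℝ) (a : Fin k → ℝ) (x : Fin k → ℝ)
    (hx : ∀ t, eval x (q t) = v t)
    (hmin : IsLocalMinOn (fun x => eval x g - ∑ r, a r * x r) {x | ∀ t, eval x (q t) = v t} x)
    (hind : ∀ c : T → ℝ, (∀ r, ∑ t, c t * eval x (pderiv r (q t)) = 0) → c = 0) :
    ∃ y : T → ℝ, ∀ l, eval x (pderiv l g) - a l - ∑ t, y t * eval x (pderiv l (q t)) = 0 := by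
  have hset : {x' | ∀ t, eval x' (q t) = v t} = {x' | ∀ t, eval x' (q t) = eval x (q t)} := by
    simp only [hx]
  rw [hset] at hmin
  let L : (Fin k → ℝ) →L[ℝ] ℝ := ∑ r, a r • (ContinuousLinearMap.proj r : (Fin k → ℝ) →L[ℝ] ℝ)
  have hL : (fun x : Fin k → ℝ => ∑ r, a r * x r) = L := by
    funext x
    simp [L]
  have hφ' : HasStrictFDerivAt (fun x => eval x g - ∑ r, a r * x r)
      (∑ r, eval x (pderiv r g) • (ContinuousLinearMap.proj r : (Fin k → ℝ) →L[ℝ] ℝ) - L) x :=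
    (hasStrictFDerivAt_eval g x).sub (by rw [hL]; exact L.hasStrictFDerivAt)
  obtain ⟨Λ, Λ₀, h0, hsum⟩ := IsLocalExtrOn.exists_multipliers_of_hasStrictFDerivAt
    (Or.inl hmin) (fun t => hasStrictFDerivAt_eval (q t) x) hφ'
  have hcoord : ∀ l, ∑ t, Λ t * eval x (pderiv l (q t)) +
      Λ₀ * (eval x (pderiv l g) - a l) = 0 := by
    intro l
    have := DFunLike.congr_fun hsum (Pi.single l 1)
    simpa [L, Pi.single_apply] using this
  have hΛ₀ : Λ₀ ≠ 0 := by
    rintro rfl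
    refine h0 (Prod.ext (hind Λ fun r => ?_) rfl)
    simpa using hcoord r
  refine ⟨fun t => -Λ t / Λ₀, fun l => ?_⟩
  have h := hcoord l
  have h2 : ∑ t, -Λ t / Λ₀ * eval x (pderiv l (q t)) =
      -(∑ t, Λ t * eval x (pderiv l (q t))) / Λ₀ := by
    rw [← Finset.sum_neg_distrib, Finset.sum_div]
    exact Finset.sum_congr rfl fun t _ => by ring
  rw [h2]
  field_simp
  linarith

end Critical

section Regular

open MeasureTheory

variable {k : ℕ} {J : Type*} [Fintype J]

/-- The perturbed equations are transversal and their Lagrange systems are nondegenerate. -/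
def IsRegularParam (p : J → MvPolynomial (Fin k) ℝ) (E Y : J → Fin k → ℝ)
    (g : MvPolynomial (Fin k) ℝ) (θ : TiltParam k J) : Prop :=
  ∀ (m : ℕ) (σ : Fin m → J), Function.Injective σ →
    (∀ (x : Fin k → ℝ) (c : Fin m → ℝ), (∀ t, eval x (tilt p E Y θ.2.1 (σ t)) = θ.1 (σ t)) →
      (∀ r, ∑ t, c t * eval x (pderiv r (tilt p E Y θ.2.1 (σ t))) = 0) → c = 0) ∧
    ∀ z w : (Fin k → ℝ) × (Fin m → ℝ),
      (∀ t, eval z.1 (tilt p E Y θ.2.1 (σ t)) - θ.1 (σ t) = 0) →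
      (∀ l, eval z.1 (pderiv l g) - θ.2.2 l -
        ∑ t, z.2 t * eval z.1 (pderiv l (tilt p E Y θ.2.1 (σ t))) = 0) →
      (∀ t, fderiv ℝ (fun z : (Fin k → ℝ) × (Fin m → ℝ) =>
        eval z.1 (tilt p E Y θ.2.1 (σ t)) - θ.1 (σ t)) z w = 0) →
      (∀ l, fderiv ℝ (fun z : (Fin k → ℝ) × (Fin m → ℝ) =>
        eval z.1 (pderiv l g) - θ.2.2 l -
        ∑ t, z.2 t * eval z.1 (pderiv l (tilt p E Y θ.2.1 (σ t)))) z w = 0) → w = 0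

lemma exists_isRegularParam [DecidableEq J] (p : J → MvPolynomial (Fin k) ℝ) (E Y : J → Fin k → ℝ)
    (g : MvPolynomial (Fin k) ℝ)
    (hEY : ∀ j, Y j = 0 ∨ ∀ i, ∑ r, Y j r * E i r = if i = j then 1 else 0)
    (U : Set (TiltParam k J)) (hU : IsOpen U) (hne : U.Nonempty) :
    ∃ θ ∈ U, IsRegularParam p E Y g θ := by
  let μ : Measure (TiltParam k J) := Measure.addHaar
  have hae : ∀ᵐ θ ∂μ, IsRegularParam p E Y g θ := by
    unfold IsRegularParam
    rw [ae_all_iff]; intro m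
    rw [ae_all_iff]; intro σ
    by_cases hσ : Function.Injective σ
    swap
    · exact Filter.Eventually.of_forall fun θ h => absurd h hσ
    have h1 : ∀ᵐ θ ∂μ, ∀ t₀, ¬ ∃ (x : Fin k → ℝ) (c : Fin m → ℝ), c t₀ = 1 ∧
        (∀ t, eval x (tilt p E Y θ.2.1 (σ t)) = θ.1 (σ t)) ∧
        ∀ r, ∑ t, c t * eval x (pderiv r (tilt p E Y θ.2.1 (σ t))) = 0 := by
      rw [ae_all_iff]; intro t₀
      rw [ae_iff]
      simpa only [not_not] using
        measure_setOf_dependent_gradients p E Y μ σ hσ t₀ (hEY (σ t₀))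
    have h2 := measure_eq_zero_iff_ae_notMem.1
      (measure_setOf_degenerate_critical_points p E Y μ g σ hσ)
    filter_upwards [h1, h2] with θ hθ1 hθ2 _
    refine ⟨fun x c hx hc => ?_, fun z w hz1 hz2 hz3 hz4 => ?_⟩
    · by_contra hne
      obtain ⟨t₀, ht₀⟩ := Function.ne_iff.1 hne
      refine hθ1 t₀ ⟨x, fun t => (c t₀)⁻¹ * c t, inv_mul_cancel₀ ht₀, hx, fun r => ?_⟩
      simp only [mul_assoc, ← Finset.mul_sum, hc r, mul_zero]
    · by_contra hne
      exact hθ2 ⟨z, w, hne, hz1, hz2, hz3, hz4⟩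
  obtain ⟨θ, hθU, hθ⟩ := (Measure.dense_of_ae hae).exists_mem_open hU hne
  exact ⟨θ, hθ, hθU⟩

end Regular

section Separation

lemma exists_isClopen_pairwise_disjoint {X : Type*} [TopologicalSpace X] [CompactSpace X] [T2Space X]
    {I : Type*} [Finite I] (z : I → X) (hz : ∀ i j, z j ∈ connectedComponent (z i) → i = j) :
    ∃ U : I → Set X, (∀ i, IsClopen (U i)) ∧ (∀ i, z i ∈ U i) ∧
      ∀ i j, i ≠ j → Disjoint (U i) (U j) := by
  have h : ∀ i j, ∃ D : Set X, IsClopen D ∧ z i ∈ D ∧ (i ≠ j → z j ∉ D) := by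
    intro i j
    by_cases hij : i = j
    · exact ⟨Set.univ, isClopen_univ, trivial, fun h => absurd hij h⟩
    have h1 : z j ∉ connectedComponent (z i) := fun h => hij (hz i j h)
    rw [connectedComponent_eq_iInter_isClopen, Set.mem_iInter] at h1
    push Not at h1
    obtain ⟨⟨D, hD, hzD⟩, hD'⟩ := h1
    exact ⟨D, hD, hzD, fun _ => hD'⟩
  choose D hD hzD hD' using h
  refine ⟨fun i => ⋂ j, {x | x ∈ D i j ∧ (i ≠ j → x ∉ D j i)}, fun i => ?_, fun i => ?_,
    fun i j hij => ?_⟩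
  · refine isClopen_iInter_of_finite fun j => ?_
    by_cases hij : i = j
    · simpa [hij] using hD j j
    · simpa [hij] using! (hD i j).inter (hD j i).compl
  · exact Set.mem_iInter.2 fun j => ⟨hzD i j, fun hij => hD' j i hij.symm⟩
  · rw [Set.disjoint_left]
    intro x hx hx'
    exact (Set.mem_iInter.1 hx j).2 hij (Set.mem_iInter.1 hx' i).1

lemma exists_isOpen_frontier_disjoint {E : Type*} [TopologicalSpace E] [T2Space E] {X : Set E}
    (hX : IsCompact X) {I : Type*} [Finite I] (z : I → E) (hzX : ∀ i, z i ∈ X)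
    (hz : ∀ i j, ∀ K ⊆ X, IsPreconnected K → z i ∈ K → z j ∈ K → i = j) :
    ∃ W : I → Set E, (∀ i, IsOpen (W i)) ∧ (∀ i, z i ∈ W i) ∧
      (∀ i j, i ≠ j → Disjoint (W i) (W j)) ∧ ∀ i, Disjoint (frontier (W i)) X := by
  have : CompactSpace X := isCompact_iff_compactSpace.1 hX
  obtain ⟨U, hU, hzU, hdisj⟩ := exists_isClopen_pairwise_disjoint
    (fun i => (⟨z i, hzX i⟩ : X)) fun i j h => by
      refine hz i j (Subtype.val '' connectedComponent (⟨z i, hzX i⟩ : X)) ?_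
        (isPreconnected_connectedComponent.image _ continuous_subtype_val.continuousOn)
        ⟨_, mem_connectedComponent, rfl⟩ ⟨_, h, rfl⟩
      rintro _ ⟨x, -, rfl⟩
      exact x.2
  have hsep : ∀ i, SeparatedNhds (Subtype.val '' U i) (Subtype.val '' (U i)ᶜ) := by
    intro i
    refine SeparatedNhds.of_isCompact_isCompact
      ((hU i).1.isCompact.image continuous_subtype_val)
      ((hU i).compl.1.isCompact.image continuous_subtype_val) ?_
    exact (Set.disjoint_image_iff Subtype.val_injective).2 disjoint_compl_right
  choose A B hA hB hUA hUB hAB using hsep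
  have hop : ∀ i, IsOpen (A i ∩ ⋂ j, {x | i ≠ j → x ∈ B j}) := by
    refine fun i => (hA i).inter (isOpen_iInter_of_finite fun j => ?_)
    by_cases hij : i = j
    · simp [hij]
    · simpa [hij] using hB j
  have hUW : ∀ i, ∀ x ∈ U i, (x : E) ∈ A i ∩ ⋂ j, {x | i ≠ j → x ∈ B j} := fun i x hx =>
    ⟨hUA i ⟨x, hx, rfl⟩, Set.mem_iInter.2 fun j hij =>
      hUB j ⟨x, Set.disjoint_left.1 (hdisj i j hij) hx, rfl⟩⟩
  refine ⟨fun i => A i ∩ ⋂ j, {x | i ≠ j → x ∈ B j}, hop, fun i => hUW i _ (hzU i),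
    fun i j hij => ?_, fun i => ?_⟩
  · rw [Set.disjoint_left]
    rintro x ⟨-, hx⟩ ⟨hx', -⟩
    exact Set.disjoint_left.1 (hAB j) hx' (Set.mem_iInter.1 hx j hij)
  · rw [Set.disjoint_left]
    rintro x hx hxX
    by_cases hxU : (⟨x, hxX⟩ : X) ∈ U i
    · rw [(hop i).frontier_eq] at hx
      exact hx.2 (hUW i _ hxU)
    · have h1 : x ∈ closure (A i) := closure_mono Set.inter_subset_left hx.1
      exact Set.disjoint_left.1 ((hAB i).closure_left (hB i)) h1 (hUB i ⟨⟨x, hxX⟩, hxU, rfl⟩)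

lemma sign_eq_of_isPreconnected {E : Type*} [TopologicalSpace E] {K : Set E}
    (hK : IsPreconnected K) {f : E → ℝ} (hf : Continuous f) {δ : ℝ} (hδ : 0 < δ)
    (h : ∀ x ∈ K, f x = 0 ∨ δ ≤ |f x|) {x y : E} (hx : x ∈ K) (hy : y ∈ K) :
    SignType.sign (f x) = SignType.sign (f y) := by
  have hoc := (hK.image f hf.continuousOn).ordConnected
  have key : ∀ x ∈ K, ∀ y ∈ K, f x ≤ 0 → 0 < f y → False := by
    intro x hx y hy hx0 hy0
    have h1 : δ ≤ f y := by
      have := (h y hy).resolve_left hy0.ne'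
      rwa [abs_of_pos hy0] at this
    obtain ⟨w, hw, hw'⟩ := hoc.out ⟨x, hx, rfl⟩ ⟨y, hy, rfl⟩
      (show δ / 2 ∈ Set.Icc (f x) (f y) from ⟨by linarith, by linarith⟩)
    rcases h w hw with h2 | h2
    · linarith
    · rw [hw', abs_of_pos (by linarith)] at h2
      linarith
  have key' : ∀ x ∈ K, ∀ y ∈ K, f x < 0 → 0 ≤ f y → False := by
    intro x hx y hy hx0 hy0
    have h1 : f x ≤ -δ := by
      have := (h x hx).resolve_left hx0.ne
      rw [abs_of_neg hx0] at this
      linarith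
    obtain ⟨w, hw, hw'⟩ := hoc.out ⟨x, hx, rfl⟩ ⟨y, hy, rfl⟩
      (show -(δ / 2) ∈ Set.Icc (f x) (f y) from ⟨by linarith, by linarith⟩)
    rcases h w hw with h2 | h2
    · linarith
    · rw [hw', abs_of_neg (by linarith)] at h2
      linarith
  rcases lt_trichotomy (f x) 0 with h1 | h1 | h1
  · have h2 : f y < 0 := not_le.1 fun h2 => key' x hx y hy h1 h2
    rw [sign_neg h1, sign_neg h2]
  · have h2 : f y = 0 := le_antisymm (not_lt.1 fun h2 => key x hx y hy h1.le h2)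
      (not_lt.1 fun h2 => key' y hy x hx h2 h1.ge)
    rw [h1, h2]
  · have h2 : 0 < f y := not_le.1 fun h2 => key y hy x hx h2 h1
    rw [sign_pos h1, sign_pos h2]

end Separation

section Count

lemma sum_option_fun_card_support {ι : Type*} [Fintype ι] [DecidableEq ι] (n : ℕ) (f : ℕ → ℕ) :
    ∑ α : ι → Option (Fin n), f (Finset.univ.filter fun p => (α p).isSome).card =
      ∑ j ∈ Finset.range (Fintype.card ι + 1), (Fintype.card ι).choose j * (n ^ j * f j) := by
  rw [← Finset.sum_fiberwise_of_maps_to (s := Finset.univ) (t := Finset.univ.powerset)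
    (g := fun α : ι → Option (Fin n) => Finset.univ.filter fun p => (α p).isSome)
    (fun α _ => Finset.mem_powerset.2 (Finset.subset_univ _))]
  have h1 : ∀ S ∈ (Finset.univ : Finset ι).powerset,
      ∑ α ∈ Finset.univ.filter (fun α : ι → Option (Fin n) =>
        (Finset.univ.filter fun p => (α p).isSome) = S),
        f (Finset.univ.filter fun p => (α p).isSome).card = n ^ S.card * f S.card := by
    intro S _
    have h2 : Finset.univ.filter (fun α : ι → Option (Fin n) =>
        (Finset.univ.filter fun p => (α p).isSome) = S) =
        Fintype.piFinset fun p => if p ∈ S then Finset.univ.image some else {none} := by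
      ext α
      simp only [Finset.mem_filter, Finset.mem_univ, true_and, Fintype.mem_piFinset,
        Finset.ext_iff]
      refine forall_congr' fun p => ?_
      by_cases hp : p ∈ S <;> cases h : α p <;> simp [hp]
    rw [Finset.sum_congr rfl fun α hα => by rw [(Finset.mem_filter.1 hα).2], Finset.sum_const, h2,
      Fintype.card_piFinset, smul_eq_mul]
    congr 1
    simp only [apply_ite Finset.card, Finset.card_singleton,
      Finset.card_image_of_injective _ (Option.some_injective _), Finset.card_univ,
      Fintype.card_fin, Finset.prod_ite_mem, Finset.univ_inter, Finset.prod_const]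
  rw [Finset.sum_congr rfl h1, Finset.sum_powerset_apply_card fun j => n ^ j * f j]
  simp [Finset.card_univ]

end Count

section Penalty

variable {k' c : ℕ} {ι : Type*}

/-- Derivatives of `Q` along the directions `E`, together with `n` copies of each `P`. -/
noncomputable def penaltyFamily (n : ℕ) (Q : MvPolynomial (Fin (k' + c)) ℝ)
    (P : ι → MvPolynomial (Fin (k' + c)) ℝ) (E : Fin c → Fin (k' + c) → ℝ) :
    Fin c ⊕ ι × Fin n → MvPolynomial (Fin (k' + c)) ℝ :=
  Sum.elim (fun l => ∑ r, C (E l r) * pderiv r Q) fun i => P i.1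

/-- The directions `E` on the first block, zero on the second. -/
def penaltyDir (ι : Type*) (n : ℕ) (E : Fin c → Fin (k' + c) → ℝ) :
    Fin c ⊕ ι × Fin n → Fin (k' + c) → ℝ :=
  Sum.elim E fun _ => 0

/-- The last `c` coordinate covectors on the first block, zero on the second. -/
def penaltyCovec (k' c : ℕ) (ι : Type*) (n : ℕ) : Fin c ⊕ ι × Fin n → Fin (k' + c) → ℝ :=
  Sum.elim (fun l => Pi.single (Fin.natAdd k' l) 1) fun _ => 0

lemma penaltyCovec_dual [DecidableEq ι] {n : ℕ} {E : Fin c → Fin (k' + c) → ℝ}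
    (hE : ∀ l j, E l (Fin.natAdd k' j) = if j = l then 1 else 0) (j : Fin c ⊕ ι × Fin n) :
    penaltyCovec k' c ι n j = 0 ∨
      ∀ i, ∑ r, penaltyCovec k' c ι n j r * penaltyDir ι n E i r = if i = j then 1 else 0 := by
  rcases j with l | j
  · right
    rintro (l' | i)
    · simp [penaltyCovec, penaltyDir, Pi.single_apply, hE, eq_comm]
    · simp [penaltyDir]
  · exact Or.inl rfl

lemma totalDegree_tilt_le {k : ℕ} {J : Type*} [Fintype J] (p : J → MvPolynomial (Fin k) ℝ)
    (E Y b : J → Fin k → ℝ) (i : J) {n : ℕ} (hn : 1 ≤ n) (hp : (p i).totalDegree ≤ n) :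
    (tilt p E Y b i).totalDegree ≤ n := by
  have h1 : ∀ a : Fin k → ℝ, (∑ r, C (a r) * X r : MvPolynomial (Fin k) ℝ).totalDegree ≤ n := by
    intro a
    refine totalDegree_finsetSum_le fun r _ => (totalDegree_mul _ _).trans ?_
    simpa using hn
  refine (totalDegree_add _ _).trans (max_le ((totalDegree_add _ _).trans (max_le hp (h1 _))) ?_)
  refine totalDegree_finsetSum_le fun l _ =>
    (totalDegree_mul (C (b l ⬝ᵥ E i)) (∑ r, C (Y l r) * X r)).trans ?_
  rw [totalDegree_C, zero_add]
  exact h1 _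

lemma totalDegree_penaltyFamily_inl_le {n : ℕ} (Q : MvPolynomial (Fin (k' + c)) ℝ)
    (P : ι → MvPolynomial (Fin (k' + c)) ℝ) (E : Fin c → Fin (k' + c) → ℝ) (l : Fin c) :
    (penaltyFamily n Q P E (Sum.inl l)).totalDegree ≤ Q.totalDegree := by
  change (∑ r, C (E l r) * pderiv r Q).totalDegree ≤ _
  refine totalDegree_finsetSum_le fun r _ => (totalDegree_mul _ _).trans ?_
  rw [totalDegree_C, zero_add]
  exact (totalDegree_pderiv_le Q r).trans (Nat.sub_le _ _)

variable [Fintype ι]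

lemma eval_tilt_penalty_inr {n : ℕ} (Q : MvPolynomial (Fin (k' + c)) ℝ)
    (P : ι → MvPolynomial (Fin (k' + c)) ℝ) (E : Fin c → Fin (k' + c) → ℝ)
    (b : Fin c ⊕ ι × Fin n → Fin (k' + c) → ℝ) (i : ι × Fin n) (x : Fin (k' + c) → ℝ) :
    eval x (tilt (penaltyFamily n Q P E) (penaltyDir ι n E) (penaltyCovec k' c ι n) b (Sum.inr i)) =
      eval x (P i.1) + ∑ r, b (Sum.inr i) r * x r := by
  simp [eval_tilt, penaltyFamily, penaltyDir]

lemma eval_tilt_penalty_inl {n : ℕ} (Q : MvPolynomial (Fin (k' + c)) ℝ)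
    (P : ι → MvPolynomial (Fin (k' + c)) ℝ) (E : Fin c → Fin (k' + c) → ℝ)
    (b : Fin c ⊕ ι × Fin n → Fin (k' + c) → ℝ) (l : Fin c) (x : Fin (k' + c) → ℝ) :
    eval x (tilt (penaltyFamily n Q P E) (penaltyDir ι n E) (penaltyCovec k' c ι n) b (Sum.inl l)) =
      ∑ r, E l r * eval x (pderiv r Q) + ∑ r, b (Sum.inl l) r * x r +
        ∑ j, (∑ r, b (Sum.inl j) r * E l r) * x (Fin.natAdd k' j) := by
  simp [eval_tilt, penaltyFamily, penaltyDir, penaltyCovec, Pi.single_apply]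

lemma hasDerivAt_penalty {n : ℕ} (Q : MvPolynomial (Fin (k' + c)) ℝ)
    (P : ι → MvPolynomial (Fin (k' + c)) ℝ) {E : Fin c → Fin (k' + c) → ℝ}
    (hE : ∀ l j, E l (Fin.natAdd k' j) = if j = l then 1 else 0)
    (b : Fin c ⊕ ι × Fin n → Fin (k' + c) → ℝ) (v : Fin c ⊕ ι × Fin n → ℝ)
    (l : Fin c) (x : Fin (k' + c) → ℝ) :
    HasDerivAt (fun s : ℝ => eval (x + s • E l) Q +
      ∑ j, (x + s • E l) (Fin.natAdd k' j) *
        (∑ r, b (Sum.inl j) r * (x + s • E l) r - v (Sum.inl j)))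
      (eval x (tilt (penaltyFamily n Q P E) (penaltyDir ι n E) (penaltyCovec k' c ι n) b
        (Sum.inl l)) - v (Sum.inl l)) 0 := by
  have hline : ∀ r, HasDerivAt (fun s : ℝ => (x + s • E l) r) (E l r) 0 := by
    intro r
    simpa using ((hasDerivAt_id (0 : ℝ)).mul_const (E l r)).const_add (x r)
  have hQ : HasDerivAt (fun s : ℝ => eval (x + s • E l) Q) (∑ r, E l r * eval x (pderiv r Q)) 0 := by
    have h1 := (hasStrictFDerivAt_eval Q (x + (0 : ℝ) • E l)).hasFDerivAt.comp_hasDerivAt (0 : ℝ)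
      (hasDerivAt_pi.2 hline)
    refine h1.congr_deriv ?_
    simp [mul_comm]
  have hq := HasDerivAt.fun_sum (u := Finset.univ) fun j (_ : j ∈ Finset.univ) =>
    (hline (Fin.natAdd k' j)).mul ((HasDerivAt.fun_sum (u := Finset.univ) fun r (_ : r ∈ Finset.univ) =>
      (hline r).const_mul (b (Sum.inl j) r)).sub_const (v (Sum.inl j)))
  refine (hQ.add hq).congr_deriv ?_
  rw [eval_tilt_penalty_inl]
  simp only [zero_smul, add_zero, hE, Finset.sum_add_distrib, ite_mul, one_mul, zero_mul,
    Finset.sum_ite_eq', Finset.mem_univ, if_true]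
  simp only [Finset.mul_sum, mul_comm]
  ring

/-- Minimisers of the perturbed penalty over small discs transversal to the variety. -/
lemma exists_mem_disc_tilt_eq {n : ℕ} (Q : MvPolynomial (Fin (k' + c)) ℝ)
    (P : ι → MvPolynomial (Fin (k' + c)) ℝ) {E : Fin c → Fin (k' + c) → ℝ}
    (hE : ∀ l j, E l (Fin.natAdd k' j) = if j = l then 1 else 0)
    (b : Fin c ⊕ ι × Fin n → Fin (k' + c) → ℝ) (v : Fin c ⊕ ι × Fin n → ℝ)
    (z : Fin (k' + c) → ℝ) (hz : eval z Q = 0) {r η : ℝ} (hr : 0 < r)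
    (hη : ∀ y : Fin c → ℝ, ‖y‖ = r → η ≤ eval (z + ∑ l, y l • E l) Q)
    (hsmall : ∀ y : Fin c → ℝ, ‖y‖ ≤ r →
      |∑ j, (z + ∑ l, y l • E l) (Fin.natAdd k' j) *
        (∑ t, b (Sum.inl j) t * (z + ∑ l, y l • E l) t - v (Sum.inl j))| < η / 2) :
    ∃ y : Fin c → ℝ, ‖y‖ ≤ r ∧ ∀ l, eval (z + ∑ l, y l • E l)
      (tilt (penaltyFamily n Q P E) (penaltyDir ι n E) (penaltyCovec k' c ι n) b (Sum.inl l)) =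
        v (Sum.inl l) := by
  let φ : (Fin (k' + c) → ℝ) → ℝ := fun x => eval x Q + ∑ j, x (Fin.natAdd k' j) *
    (∑ t, b (Sum.inl j) t * x t - v (Sum.inl j))
  let L : (Fin c → ℝ) → Fin (k' + c) → ℝ := fun y => z + ∑ l, y l • E l
  have hφ : Continuous φ := by
    have := (differentiable_eval_mvPolynomial Q).continuous
    fun_prop
  have hL : Continuous L := by fun_prop
  obtain ⟨y, hy, hmin⟩ := (isCompact_closedBall (0 : Fin c → ℝ) r).exists_isMinOn
    ⟨0, by simpa using hr.le⟩ (hφ.comp hL).continuousOn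
  rw [mem_closedBall_zero_iff] at hy
  have h0 : φ (L y) < η / 2 := by
    have h1 : φ (L y) ≤ φ (L 0) := hmin (by simpa using hr.le)
    have h2 := (abs_lt.1 (hsmall 0 (by simpa using hr.le))).2
    have h3 : φ (L 0) = 0 + ∑ j, (z + ∑ l, (0 : Fin c → ℝ) l • E l) (Fin.natAdd k' j) *
        (∑ t, b (Sum.inl j) t * (z + ∑ l, (0 : Fin c → ℝ) l • E l) t - v (Sum.inl j)) := by
      rw [← hz]
      simp [φ, L]
    linarith
  have hlt : ‖y‖ < r := by
    refine hy.lt_of_ne fun h => ?_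
    have h1 := hη y h
    have h2 := (abs_lt.1 (hsmall y hy)).1
    have h3 : φ (L y) = eval (z + ∑ l, y l • E l) Q +
      ∑ j, (z + ∑ l, y l • E l) (Fin.natAdd k' j) *
        (∑ t, b (Sum.inl j) t * (z + ∑ l, y l • E l) t - v (Sum.inl j)) := rfl
    linarith
  refine ⟨y, hy, fun l => ?_⟩
  have hd := hasDerivAt_penalty (n := n) Q P hE b v l (L y)
  have hcurve : ∀ s : ℝ, L y + s • E l = L (y + s • Pi.single l 1) := by
    intro s
    simp only [L, Pi.add_apply, Pi.smul_apply, add_smul, Finset.sum_add_distrib, add_assoc]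
    congr 2
    simp [Pi.single_apply]
  have hloc : IsLocalMin (fun s : ℝ => φ (L y + s • E l)) 0 := by
    have hc : Continuous fun s : ℝ => ‖y + s • (Pi.single l 1 : Fin c → ℝ)‖ := by fun_prop
    have hev : ∀ᶠ s in nhds (0 : ℝ), ‖y + s • (Pi.single l 1 : Fin c → ℝ)‖ < r :=
      hc.continuousAt.eventually_lt continuousAt_const (by simpa using hlt)
    filter_upwards [hev] with s hs
    have h1 : φ (L y) ≤ φ (L (y + s • Pi.single l 1)) :=
      hmin (mem_closedBall_zero_iff.2 hs.le)
    simpa [hcurve s] using h1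
  exact sub_eq_zero.1 (hloc.hasDerivAt_eq_zero hd)

/-- Critical points of a regular perturbation, classified by their active constraints. -/
lemma card_le_of_isLocalMinOn [DecidableEq ι] (n d₁ d D : ℕ) (hd₁ : 1 ≤ d₁) (hd : IsEmpty ι ∨ 1 ≤ d)
    (hd₁D : d₁ ≤ D) (hdD : d ≤ D) (Q g : MvPolynomial (Fin (k' + c)) ℝ)
    (hQ : Q.totalDegree ≤ d₁) (hg : g.totalDegree ≤ D)
    (P : ι → MvPolynomial (Fin (k' + c)) ℝ) (hP : ∀ i, (P i).totalDegree ≤ d)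
    (E : Fin c → Fin (k' + c) → ℝ) (θ : TiltParam (k' + c) (Fin c ⊕ ι × Fin n))
    (hθ : IsRegularParam (penaltyFamily n Q P E) (penaltyDir ι n E) (penaltyCovec k' c ι n) g θ)
    {I : Type*} [Fintype I] (x : I → Fin (k' + c) → ℝ) (hx : Function.Injective x)
    (α : I → ι → Option (Fin n))
    (hmem : ∀ i, (∀ l, eval (x i) (tilt (penaltyFamily n Q P E) (penaltyDir ι n E)
        (penaltyCovec k' c ι n) θ.2.1 (Sum.inl l)) = θ.1 (Sum.inl l)) ∧
      ∀ p τ, α i p = some τ → eval (x i) (tilt (penaltyFamily n Q P E) (penaltyDir ι n E)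
        (penaltyCovec k' c ι n) θ.2.1 (Sum.inr (p, τ))) = θ.1 (Sum.inr (p, τ)))
    (hmin : ∀ i, IsLocalMinOn (fun x => eval x g - ∑ r, θ.2.2 r * x r)
      {x | (∀ l, eval x (tilt (penaltyFamily n Q P E) (penaltyDir ι n E)
        (penaltyCovec k' c ι n) θ.2.1 (Sum.inl l)) = θ.1 (Sum.inl l)) ∧
      ∀ p τ, α i p = some τ → eval x (tilt (penaltyFamily n Q P E) (penaltyDir ι n E)
        (penaltyCovec k' c ι n) θ.2.1 (Sum.inr (p, τ))) = θ.1 (Sum.inr (p, τ))} (x i)) :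
    Fintype.card I ≤ ∑ j ∈ Finset.range (Fintype.card ι + 1), (Fintype.card ι).choose j *
      (n ^ j * ((k' + c).choose (c + j) * (d₁ ^ c * d ^ j) * D ^ (k' + c - (c + j)))) := by
  classical
  rw [← sum_option_fun_card_support n fun j =>
    (k' + c).choose (c + j) * (d₁ ^ c * d ^ j) * D ^ (k' + c - (c + j)), ← Finset.card_univ,
    Finset.card_eq_sum_card_fiberwise (f := α) (t := Finset.univ) fun _ _ => Finset.mem_univ _]
  refine Finset.sum_le_sum fun β _ => ?_
  let T := Fin c ⊕ {p // (β p).isSome}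
  have hT : Fintype.card T = c + (Finset.univ.filter fun p => (β p).isSome).card := by
    simp [T, Fintype.card_subtype]
  let e : Fin (c + (Finset.univ.filter fun p => (β p).isSome).card) ≃ T :=
    (Fintype.equivFinOfCardEq hT).symm
  let u : T → Fin c ⊕ ι × Fin n := Sum.map id fun p => (p.1, (β p.1).get p.2)
  have hu : Function.Injective u := by
    refine Function.Injective.sumMap Function.injective_id fun p p' h => ?_
    exact Subtype.ext (congrArg Prod.fst h)
  have hσ : Function.Injective (u ∘ e) := hu.comp e.injective
  have hset : ∀ x, (∀ t, eval x (tilt (penaltyFamily n Q P E) (penaltyDir ι n E)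
        (penaltyCovec k' c ι n) θ.2.1 ((u ∘ e) t)) = θ.1 ((u ∘ e) t)) ↔
      ((∀ l, eval x (tilt (penaltyFamily n Q P E) (penaltyDir ι n E)
        (penaltyCovec k' c ι n) θ.2.1 (Sum.inl l)) = θ.1 (Sum.inl l)) ∧
      ∀ p τ, β p = some τ → eval x (tilt (penaltyFamily n Q P E) (penaltyDir ι n E)
        (penaltyCovec k' c ι n) θ.2.1 (Sum.inr (p, τ))) = θ.1 (Sum.inr (p, τ))) := by
    intro x
    constructor
    · intro h
      refine ⟨fun l => ?_, fun p τ hp => ?_⟩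
      · simpa [u] using h (e.symm (Sum.inl l))
      · simpa [u, hp] using h (e.symm (Sum.inr ⟨p, by simp [hp]⟩))
    · rintro ⟨h1, h2⟩ t
      rw [Function.comp_apply]
      rcases e t with l | p
      · exact h1 l
      · exact h2 _ _ (Option.some_get _).symm
  let deg : T → ℕ := Sum.elim (fun _ => d₁) fun _ => d
  have hdeg : ∀ t, (tilt (penaltyFamily n Q P E) (penaltyDir ι n E)
      (penaltyCovec k' c ι n) θ.2.1 (u t)).totalDegree ≤ deg t := by
    rintro (l | p)
    · exact totalDegree_tilt_le _ _ _ _ _ hd₁ ((totalDegree_penaltyFamily_inl_le Q P E l).trans hQ)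
    · exact totalDegree_tilt_le _ _ _ _ _ (hd.resolve_left fun h => h.elim p.1) (hP p.1)
  have hdegD : ∀ t, deg t ≤ D := by
    rintro (l | p)
    · exact hd₁D
    · exact hdD
  have hprod : ∏ t, deg (e t) = d₁ ^ c * d ^ (Finset.univ.filter fun p => (β p).isSome).card := by
    rw [Equiv.prod_comp e deg, Fintype.prod_sum_type]
    simp [deg, Fintype.card_subtype]
  obtain ⟨hreg1, hreg2⟩ := hθ _ _ hσ
  have key := card_critical_points_le g (fun t => tilt (penaltyFamily n Q P E) (penaltyDir ι n E)
      (penaltyCovec k' c ι n) θ.2.1 ((u ∘ e) t)) (fun t => θ.1 ((u ∘ e) t)) θ.2.2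
    (fun t => deg (e t)) D (fun t => hdeg (e t)) (fun t => (hdeg (e t)).trans (hdegD _)) hg
    ((Finset.univ.filter fun i => α i = β).image x) (by
      intro w hw
      obtain ⟨i, hi, rfl⟩ := Finset.mem_image.1 hw
      obtain rfl : α i = β := (Finset.mem_filter.1 hi).2
      have hxi := (hset (x i)).2 (hmem i)
      have hm := hmin i
      rw [← Set.ext hset] at hm
      obtain ⟨y, hy⟩ := exists_multipliers_of_isLocalMinOn g _ _ θ.2.2 (x i) hxi hm
        fun c hc => hreg1 (x i) c hxi hc
      exact ⟨y, hxi, hy⟩) hreg2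
  rwa [hprod, Finset.card_image_of_injective _ hx] at key

end Penalty

section Core

open Filter Topology

lemma exists_isOpen_sign_separating {E : Type*} [TopologicalSpace E] [T2Space E] {B : Set E}
    (hB : IsCompact B) {ι I : Type*} [Finite I] {f : E → ℝ} (hf : Continuous f)
    {P : ι → E → ℝ} (hP : ∀ p, Continuous (P p)) {δ : ℝ} (hδ : 0 < δ) (z : I → E)
    (hzB : ∀ i, z i ∈ B) (hzf : ∀ i, f (z i) = 0) (hzP : ∀ i p, P p (z i) = 0 ∨ δ ≤ |P p (z i)|)
    (hsep : ∀ i j, ∀ K ⊆ {x | f x = 0}, IsPreconnected K → z i ∈ K → z j ∈ K →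
      (∀ x ∈ K, ∀ p, SignType.sign (P p x) = SignType.sign (P p (z i))) → i = j) :
    ∃ W : I → Set E, (∀ i, IsOpen (W i)) ∧ (∀ i, z i ∈ W i) ∧
      (∀ i j, i ≠ j → Disjoint (W i) (W j)) ∧
      ∀ i, ∀ x ∈ frontier (W i), x ∈ B → f x = 0 → ¬ ∀ p, P p x = 0 ∨ δ ≤ |P p x| := by
  have hclosed : IsClosed {x | f x = 0 ∧ ∀ p, P p x = 0 ∨ δ ≤ |P p x|} := by
    rw [show {x | f x = 0 ∧ ∀ p, P p x = 0 ∨ δ ≤ |P p x|} =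
      {x | f x = 0} ∩ ⋂ p, ({x | P p x = 0} ∪ {x | δ ≤ |P p x|}) by ext; simp]
    refine (isClosed_eq hf continuous_const).inter ?_
    exact isClosed_iInter fun p => (isClosed_eq (hP p) continuous_const).union
      (isClosed_le continuous_const (hP p).abs)
  obtain ⟨W, h1, h2, h3, h4⟩ := exists_isOpen_frontier_disjoint (hB.inter_right hclosed) z
    (fun i => ⟨hzB i, hzf i, hzP i⟩) fun i j K hK hKc hi hj =>
      hsep i j K (fun x hx => (hK hx).2.1) hKc hi hj fun x hx p =>
        sign_eq_of_isPreconnected hKc (hP p) hδ (fun y hy => (hK hy).2.2 p) hx hi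
  exact ⟨W, h1, h2, h3, fun i x hx hxB hxf hxP =>
    Set.disjoint_left.1 (h4 i) hx ⟨hxB, hxf, hxP⟩⟩

lemma eventually_forall_mem_lt_or {E : Type*} [TopologicalSpace E] {K : Set E}
    (hK : IsCompact K) {ι : Type*} {f : E → ℝ} (hf : Continuous f) (hf0 : ∀ x, 0 ≤ f x)
    {P : ι → E → ℝ} (hP : ∀ p, Continuous (P p)) {δ : ℝ}
    (h : ∀ x ∈ K, f x = 0 → ¬ ∀ p, P p x = 0 ∨ δ ≤ |P p x|) :
    ∀ᶠ η in 𝓝 (0 : ℝ), ∀ x ∈ K, η < f x ∨ ∃ p, η < |P p x| ∧ |P p x| < δ - η := by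
  refine hK.eventually_forall_of_forall_eventually fun x hx => ?_
  rcases (hf0 x).eq_or_lt with h0 | h0
  · have h1 := h x hx h0.symm
    push Not at h1
    obtain ⟨p, hp0, hpδ⟩ := h1
    have e1 : ∀ᶠ w in 𝓝 ((0 : ℝ), x), w.1 < |P p w.2| :=
      continuous_fst.continuousAt.eventually_lt ((hP p).comp continuous_snd).abs.continuousAt
        (by simpa using hp0)
    have e2 : ∀ᶠ w in 𝓝 ((0 : ℝ), x), |P p w.2| < δ - w.1 :=
      ((hP p).comp continuous_snd).abs.continuousAt.eventually_lt
        (continuous_const.sub continuous_fst).continuousAt (by simpa using hpδ)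
    filter_upwards [e1, e2] with w hw1 hw2 using Or.inr ⟨p, hw1, hw2⟩
  · have e1 : ∀ᶠ w in 𝓝 ((0 : ℝ), x), w.1 < f w.2 :=
      continuous_fst.continuousAt.eventually_lt (hf.comp continuous_snd).continuousAt
        (by simpa using h0)
    filter_upwards [e1] with w hw using Or.inl hw

lemma eventually_forall_mem_abs_lt {Θ E : Type*} [TopologicalSpace Θ] [TopologicalSpace E]
    {K : Set E} (hK : IsCompact K) {F : Θ → E → ℝ} (hF : Continuous fun w : Θ × E => F w.1 w.2)
    {θ₀ : Θ} (h0 : ∀ x, F θ₀ x = 0) {ε : ℝ} (hε : 0 < ε) :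
    ∀ᶠ θ in 𝓝 θ₀, ∀ x ∈ K, |F θ x| < ε := by
  refine hK.eventually_forall_of_forall_eventually fun x _ => ?_
  exact hF.abs.continuousAt.eventually_lt continuousAt_const (by simpa [h0] using hε)

/-- The region cut out by four ordered levels of each function. -/
def fourLevelSet {E ι : Type*} (h : ι → Fin 4 → E → ℝ) : Set E :=
  {x | ∀ p, h p 0 x ≤ 0 ∨ (0 ≤ h p 1 x ∧ h p 2 x ≤ 0) ∨ 0 ≤ h p 3 x}

lemma isClosed_fourLevelSet {E ι : Type*} [TopologicalSpace E] {h : ι → Fin 4 → E → ℝ}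
    (hh : ∀ p τ, Continuous (h p τ)) : IsClosed (fourLevelSet h) := by
  rw [show fourLevelSet h = ⋂ p, ({x | h p 0 x ≤ 0} ∪ (({x | 0 ≤ h p 1 x} ∩ {x | h p 2 x ≤ 0}) ∪
    {x | 0 ≤ h p 3 x})) by ext; simp [fourLevelSet]]
  exact isClosed_iInter fun p => (isClosed_le (hh p 0) continuous_const).union
    (((isClosed_le continuous_const (hh p 1)).inter (isClosed_le (hh p 2) continuous_const)).union
      (isClosed_le continuous_const (hh p 3)))

lemma exists_isLocalMinOn_active {E ι L : Type*} [TopologicalSpace E] [T2Space E] [Finite ι]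
    {f N : E → ℝ} (hf : Continuous f) (hN : Continuous N) {A : L → E → ℝ}
    (hA : ∀ l, Continuous (A l)) {h : ι → Fin 4 → E → ℝ} (hh : ∀ p τ, Continuous (h p τ))
    {W : Set E} (hW : IsOpen W) {R : ℝ} (hB : IsCompact {x | N x ≤ R})
    (hmid : ∀ x, N x ≤ R → ∀ p, (h p 1 x = 0 → h p 2 x < 0) ∧ (h p 2 x = 0 → 0 < h p 1 x))
    {y : E} (hyW : y ∈ W) (hyN : N y ≤ R) (hyA : ∀ l, A l y = 0) (hyT : y ∈ fourLevelSet h)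
    (hbd : ∀ x, N x ≤ R → x ∈ fourLevelSet h → x ∈ frontier W ∨ N x = R → f y < f x) :
    ∃ x ∈ W, ∃ α : ι → Option (Fin 4),
      ((∀ l, A l x = 0) ∧ ∀ p τ, α p = some τ → h p τ x = 0) ∧
      IsLocalMinOn f {x | (∀ l, A l x = 0) ∧ ∀ p τ, α p = some τ → h p τ x = 0} x := by
  classical
  have hclosed : IsClosed (closure W ∩ (⋂ l, {x | A l x = 0}) ∩ fourLevelSet h) :=
    (isClosed_closure.inter (isClosed_iInter fun l => isClosed_eq (hA l) continuous_const)).inter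
      (isClosed_fourLevelSet hh)
  obtain ⟨x, ⟨hxN, ⟨hxcl, hxA⟩, hxT⟩, hmin⟩ := (hB.inter_right hclosed).exists_isMinOn
    ⟨y, hyN, ⟨subset_closure hyW, Set.mem_iInter.2 hyA⟩, hyT⟩ hf.continuousOn
  have hyC : f x ≤ f y := hmin ⟨hyN, ⟨subset_closure hyW, Set.mem_iInter.2 hyA⟩, hyT⟩
  have hxW : x ∈ W := by
    by_contra hx
    exact absurd (hbd x hxN hxT (Or.inl (by rw [hW.frontier_eq]; exact ⟨hxcl, hx⟩))) (not_lt.2 hyC)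
  have hxR : N x < R := lt_of_le_of_ne hxN fun hx =>
    absurd (hbd x hxN hxT (Or.inr hx)) (not_lt.2 hyC)
  have hα : ∀ p, ∃ o : Option (Fin 4), (∀ τ, o = some τ → h p τ x = 0) ∧
      (o = none → ∀ τ, h p τ x ≠ 0) := by
    intro p
    by_cases hp : ∃ τ, h p τ x = 0
    · obtain ⟨τ, hτ⟩ := hp
      exact ⟨some τ, fun τ' hτ' => Option.some_injective _ hτ' ▸ hτ, fun h => by simp at h⟩
    · exact ⟨none, fun τ hτ => by simp at hτ, fun _ τ hτ => hp ⟨τ, hτ⟩⟩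
  choose α hα1 hα2 using hα
  refine ⟨x, hxW, α, ⟨fun l => Set.mem_iInter.1 hxA l, hα1⟩, ?_⟩
  have e1 : ∀ᶠ w in 𝓝 x, w ∈ W := hW.mem_nhds hxW
  have e2 : ∀ᶠ w in 𝓝 x, N w < R := hN.continuousAt.eventually_lt continuousAt_const hxR
  have e3 : ∀ᶠ w in 𝓝 x, ∀ p, α p = none →
      (h p 0 w ≤ 0 ∨ (0 ≤ h p 1 w ∧ h p 2 w ≤ 0) ∨ 0 ≤ h p 3 w) := by
    rw [eventually_all]
    intro p
    by_cases hp : α p = none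
    swap
    · exact Eventually.of_forall fun w h => absurd h hp
    have hpos : ∀ τ, 0 ≤ h p τ x → ∀ᶠ w in 𝓝 x, 0 ≤ h p τ w := fun τ hτ =>
      (continuousAt_const.eventually_lt (hh p τ).continuousAt
        (hτ.lt_of_ne (hα2 p hp τ).symm)).mono fun w hw => hw.le
    have hneg : ∀ τ, h p τ x ≤ 0 → ∀ᶠ w in 𝓝 x, h p τ w ≤ 0 := fun τ hτ =>
      ((hh p τ).continuousAt.eventually_lt continuousAt_const
        (hτ.lt_of_ne (hα2 p hp τ))).mono fun w hw => hw.le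
    rcases hxT p with h1 | h1 | h1
    · exact (hneg 0 h1).mono fun w hw _ => Or.inl hw
    · exact ((hpos 1 h1.1).and (hneg 2 h1.2)).mono fun w hw _ => Or.inr (Or.inl hw)
    · exact (hpos 3 h1).mono fun w hw _ => Or.inr (Or.inr hw)
  refine eventually_nhdsWithin_iff.2 ?_
  filter_upwards [e1, e2, e3] with w hw1 hw2 hw3 hw
  refine hmin ⟨hw2.le, ⟨subset_closure hw1, Set.mem_iInter.2 hw.1⟩, fun p => ?_⟩
  cases hp : α p with
  | none => exact hw3 p hp
  | some τ =>
    have h0 := hw.2 p τ hp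
    have hm := hmid w hw2.le p
    fin_cases τ
    · exact Or.inl h0.le
    · exact Or.inr (Or.inl ⟨h0.ge, (hm.1 h0).le⟩)
    · exact Or.inr (Or.inl ⟨(hm.2 h0).le, h0.le⟩)
    · exact Or.inr (Or.inr h0.ge)

end Core

section Core

open Filter Topology

lemma isCompact_setOf_sum_sq_le {n : ℕ} {R : ℝ} (hR : 1 ≤ R) :
    IsCompact {x : Fin n → ℝ | ∑ r, x r ^ 2 ≤ R} := by
  refine Metric.isCompact_of_isClosed_isBounded
    (isClosed_le (by fun_prop) continuous_const) ?_
  refine (Metric.isBounded_closedBall (x := (0 : Fin n → ℝ)) (r := R)).subset fun x hx => ?_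
  rw [mem_closedBall_zero_iff, pi_norm_le_iff_of_nonneg (by linarith)]
  intro r
  have h1 : x r ^ 2 ≤ R := (Finset.single_le_sum (f := fun r => x r ^ 2)
    (fun r _ => sq_nonneg _) (Finset.mem_univ r)).trans hx
  rw [Real.norm_eq_abs]
  refine abs_le_of_sq_le_sq' (by nlinarith) (by linarith) |> abs_le.2

variable {k' c : ℕ} {ι : Type*}

lemma exists_disc_subset_of_eventually {E : Fin c → Fin (k' + c) → ℝ} {z : Fin (k' + c) → ℝ}
    {G : (Fin (k' + c) → ℝ) → Prop} (hG : ∀ᶠ x in 𝓝 z, G x) :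
    ∃ r > 0, ∀ y : Fin c → ℝ, ‖y‖ < r → G (z + ∑ l, y l • E l) := by
  have hL : Continuous fun y : Fin c → ℝ => z + ∑ l, y l • E l := by fun_prop
  have h1 : ∀ᶠ y in 𝓝 (0 : Fin c → ℝ), G (z + ∑ l, y l • E l) :=
    hL.continuousAt.eventually (by simpa using hG)
  obtain ⟨r, hr, h⟩ := Metric.eventually_nhds_iff.1 h1
  exact ⟨r, hr, fun y hy => h (by simpa using hy)⟩

/-- Points of a variety of small dimension that are pairwise separated by the sign conditions
of a family of polynomials are bounded in number. -/
theorem card_le_of_separated [Fintype ι] (d₁ d D : ℕ) (hd₁ : 2 ≤ d₁) (hd : IsEmpty ι ∨ 1 ≤ d)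
    (hd₁D : d₁ ≤ D) (hdD : d ≤ D) (Q : MvPolynomial (Fin (k' + c)) ℝ)
    (hQ0 : ∀ x, 0 ≤ eval x Q) (hQ : Q.totalDegree ≤ d₁)
    (hdim : dimH {x | eval x Q = 0} ≤ (k' : ℝ≥0∞))
    (P : ι → MvPolynomial (Fin (k' + c)) ℝ) (hP : ∀ i, (P i).totalDegree ≤ d)
    {I : Type*} [Fintype I] (z : I → Fin (k' + c) → ℝ) (hz : ∀ i, eval (z i) Q = 0)
    (hsep : ∀ i j, ∀ K ⊆ {x | eval x Q = 0}, IsPreconnected K → z i ∈ K → z j ∈ K →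
      (∀ x ∈ K, ∀ p, SignType.sign (eval x (P p)) = SignType.sign (eval (z i) (P p))) → i = j) :
    Fintype.card I ≤ ∑ j ∈ Finset.range (Fintype.card ι + 1), (Fintype.card ι).choose j *
      (4 ^ j * ((k' + c).choose (c + j) * (d₁ ^ c * d ^ j) * D ^ (k' + c - (c + j)))) := by
  classical
  have hQc : Continuous fun x : Fin (k' + c) → ℝ => eval x Q :=
    (differentiable_eval_mvPolynomial Q).continuous
  have hPc : ∀ p, Continuous fun x : Fin (k' + c) → ℝ => eval x (P p) :=
    fun p => (differentiable_eval_mvPolynomial (P p)).continuous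
  let N : (Fin (k' + c) → ℝ) → ℝ := fun x => ∑ r, x r ^ 2
  have hNc : Continuous N := by fun_prop
  have hN0 : ∀ x, 0 ≤ N x := fun x => Finset.sum_nonneg fun r _ => sq_nonneg _
  obtain ⟨R, hR2, hzR⟩ : ∃ R : ℝ, 2 ≤ R ∧ ∀ i, N (z i) + 2 ≤ R := by
    refine ⟨∑ i, N (z i) + 2, by have := Finset.sum_nonneg fun i (_ : i ∈ Finset.univ) => hN0 (z i)
                                 linarith, fun i => ?_⟩
    have := Finset.single_le_sum (f := fun i => N (z i)) (fun i _ => hN0 _) (Finset.mem_univ i)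
    simpa using this
  have hB : IsCompact {x | N x ≤ R} := isCompact_setOf_sum_sq_le (by linarith)
  obtain ⟨δ, hδz, hδ⟩ : ∃ δ : ℝ, (∀ i p, eval (z i) (P p) ≠ 0 → 2 * δ < |eval (z i) (P p)|) ∧
      0 < δ := by
    have h1 : ∀ᶠ δ in 𝓝 (0 : ℝ), ∀ i p, eval (z i) (P p) ≠ 0 →
        2 * δ < |eval (z i) (P p)| := by
      rw [eventually_all]; intro i
      rw [eventually_all]; intro p
      by_cases hp : eval (z i) (P p) = 0
      · exact Eventually.of_forall fun _ h => absurd hp h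
      have hc : Continuous fun δ : ℝ => 2 * δ := by fun_prop
      exact (hc.continuousAt.eventually_lt continuousAt_const
        (by simpa using hp)).mono fun δ hδ _ => hδ
    exact ((h1.filter_mono nhdsWithin_le_nhds).and
      (self_mem_nhdsWithin : Set.Ioi (0 : ℝ) ∈ 𝓝[>] 0)).exists
  obtain ⟨W, hWo, hzW, hWd, hWf⟩ := exists_isOpen_sign_separating hB hQc hPc hδ z
    (fun i => show N (z i) ≤ R by linarith [hzR i]) hz (fun i p => by
      by_cases hp : eval (z i) (P p) = 0
      · exact Or.inl hp
      · exact Or.inr (by linarith [hδz i p hp])) hsep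
  obtain ⟨η, ⟨hηW, hηδ⟩, hη⟩ : ∃ η : ℝ, ((∀ i, ∀ x ∈ frontier (W i) ∩ {x | N x ≤ R},
      η < eval x Q ∨ ∃ p, η < |eval x (P p)| ∧ |eval x (P p)| < δ - η) ∧ η < δ) ∧ 0 < η := by
    have h1 : ∀ᶠ η in 𝓝 (0 : ℝ), ∀ i, ∀ x ∈ frontier (W i) ∩ {x | N x ≤ R},
        η < eval x Q ∨ ∃ p, η < |eval x (P p)| ∧ |eval x (P p)| < δ - η := by
      rw [eventually_all]; intro i
      exact eventually_forall_mem_lt_or (hB.inter_left isClosed_frontier) hQc hQ0 hPc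
        fun x hx => hWf i x hx.1 hx.2
    exact (((h1.and (gt_mem_nhds hδ)).filter_mono nhdsWithin_le_nhds).and
      (self_mem_nhdsWithin : Set.Ioi (0 : ℝ) ∈ 𝓝[>] 0)).exists
  obtain ⟨τ, hτ, hτR, hτη⟩ : ∃ τ : ℝ, 0 < τ ∧ τ * R = η / 4 ∧ τ ≤ η / 8 := by
    refine ⟨η / (4 * R), by positivity, by field_simp, ?_⟩
    exact div_le_div_of_nonneg_left hη.le (by norm_num) (by linarith)
  obtain ⟨E, hE, hEz⟩ := exists_directions_avoiding {x | eval x Q = 0} hdim (Set.range z)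
    (Set.finite_range z)
  have hnear : ∀ i, ∀ᶠ x in 𝓝 (z i), x ∈ W i ∧ N x < R - 1 ∧ eval x Q < τ / 4 ∧
      ∀ p, |eval x (P p)| < η / 4 ∨ 2 * δ < |eval x (P p)| := by
    intro i
    have hW_mem : ∀ᶠ x in 𝓝 (z i), x ∈ W i := (hWo i).mem_nhds (hzW i)
    refine hW_mem.and
      ((hNc.continuousAt.eventually_lt continuousAt_const (by linarith [hzR i])).and
      ((hQc.continuousAt.eventually_lt continuousAt_const (by rw [hz i]; positivity)).and ?_))
    rw [eventually_all]
    intro p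
    by_cases hp : eval (z i) (P p) = 0
    · exact ((hPc p).abs.continuousAt.eventually_lt continuousAt_const
        (by rw [hp, abs_zero]; positivity)).mono fun x hx => Or.inl hx
    · exact (continuousAt_const.eventually_lt (hPc p).abs.continuousAt
        (hδz i p hp)).mono fun x hx => Or.inr hx
  have hdisc : ∀ i, ∃ r > 0, ∃ κ > 0,
      (∀ y : Fin c → ℝ, ‖y‖ ≤ r → (z i + ∑ l, y l • E l ∈ W i ∧ N (z i + ∑ l, y l • E l) < R - 1 ∧
        eval (z i + ∑ l, y l • E l) Q < τ / 4 ∧ ∀ p, |eval (z i + ∑ l, y l • E l) (P p)| < η / 4 ∨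
          2 * δ < |eval (z i + ∑ l, y l • E l) (P p)|)) ∧
      ∀ y : Fin c → ℝ, ‖y‖ = r → κ ≤ eval (z i + ∑ l, y l • E l) Q := by
    intro i
    obtain ⟨r₀, hr₀, hG⟩ := exists_disc_subset_of_eventually (E := E) (hnear i)
    obtain ⟨r, hr, hrr, hav⟩ := hEz (z i) ⟨i, rfl⟩ r₀ hr₀
    obtain ⟨κ, hκ, hκ'⟩ := (isCompact_sphere (0 : Fin c → ℝ) r).exists_forall_le'
      (f := fun y => eval (z i + ∑ l, y l • E l) Q) (a := 0)
      (Continuous.continuousOn (hQc.comp (f := fun y : Fin c → ℝ => z i + ∑ l, y l • E l)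
        (by fun_prop))) fun y hy => (hQ0 _).lt_of_ne fun h =>
          hav y (by simpa using hy) h.symm
    exact ⟨r, hr, κ, hκ, fun y hy => hG y (hy.trans_lt hrr), fun y hy => hκ' y (by simpa using hy)⟩
  choose r hr κ hκ hG hrκ using hdisc
  let thr : Fin 4 → ℝ := ![-δ, -(η / 2), η / 2, δ]
  let θ₀ : TiltParam (k' + c) (Fin c ⊕ ι × Fin 4) := (Sum.elim 0 fun i => thr i.2, 0, 0)
  let g : MvPolynomial (Fin (k' + c)) ℝ := Q + C τ * ∑ t, X t ^ 2
  have hgval : ∀ x, eval x g = eval x Q + τ * N x := fun x => by simp [g, N]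
  have hg : g.totalDegree ≤ D := by
    refine (totalDegree_add _ _).trans (max_le (hQ.trans hd₁D) ((totalDegree_mul _ _).trans ?_))
    rw [totalDegree_C, zero_add]
    exact totalDegree_finsetSum_le fun t _ => by
      simpa using hd₁.trans hd₁D
  have ev1 : ∀ᶠ θ in 𝓝 θ₀, ∀ i : ι × Fin 4, ∀ x ∈ {x | N x ≤ R},
      |∑ t, θ.2.1 (Sum.inr i) t * x t - (θ.1 (Sum.inr i) - thr i.2)| < η / 4 := by
    rw [eventually_all]; intro i
    exact eventually_forall_mem_abs_lt hB (F := fun (θ : TiltParam (k' + c) (Fin c ⊕ ι × Fin 4)) x =>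
      ∑ t, θ.2.1 (Sum.inr i) t * x t - (θ.1 (Sum.inr i) - thr i.2)) (by fun_prop)
      (fun x => by simp [θ₀]) (by positivity)
  have ev2 : ∀ᶠ θ in 𝓝 θ₀, ∀ i : I, ∀ x ∈ {x | N x ≤ R},
      |∑ j, x (Fin.natAdd k' j) * (∑ t, θ.2.1 (Sum.inl j) t * x t - θ.1 (Sum.inl j))| <
        κ i / 2 := by
    rw [eventually_all]; intro i
    exact eventually_forall_mem_abs_lt hB (F := fun (θ : TiltParam (k' + c) (Fin c ⊕ ι × Fin 4)) x =>
      ∑ j, x (Fin.natAdd k' j) * (∑ t, θ.2.1 (Sum.inl j) t * x t - θ.1 (Sum.inl j))) (by fun_prop)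
      (fun x => by simp [θ₀]) (by have := hκ i; positivity)
  have ev3 : ∀ᶠ θ in 𝓝 θ₀, ∀ x ∈ {x | N x ≤ R}, |∑ t, θ.2.2 t * x t| < τ / 4 :=
    eventually_forall_mem_abs_lt hB (F := fun (θ : TiltParam (k' + c) (Fin c ⊕ ι × Fin 4)) x =>
      ∑ t, θ.2.2 t * x t) (by fun_prop) (fun x => by simp [θ₀]) (by positivity)
  obtain ⟨U, hUsub, hUo, hθ₀U⟩ := mem_nhds_iff.1 (ev1.and (ev2.and ev3))
  obtain ⟨θ, hθU, hθ⟩ := exists_isRegularParam (penaltyFamily 4 Q P E) (penaltyDir ι 4 E)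
    (penaltyCovec k' c ι 4) g (penaltyCovec_dual hE) U hUo ⟨θ₀, hθ₀U⟩
  obtain ⟨hθ1, hθ2, hθ3⟩ := hUsub hθU
  let A : Fin c → (Fin (k' + c) → ℝ) → ℝ := fun l x =>
    eval x (tilt (penaltyFamily 4 Q P E) (penaltyDir ι 4 E) (penaltyCovec k' c ι 4) θ.2.1
      (Sum.inl l)) - θ.1 (Sum.inl l)
  let h : ι → Fin 4 → (Fin (k' + c) → ℝ) → ℝ := fun p σ x =>
    eval x (tilt (penaltyFamily 4 Q P E) (penaltyDir ι 4 E) (penaltyCovec k' c ι 4) θ.2.1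
      (Sum.inr (p, σ))) - θ.1 (Sum.inr (p, σ))
  let f : (Fin (k' + c) → ℝ) → ℝ := fun x => eval x g - ∑ t, θ.2.2 t * x t
  have hval : ∀ p σ x, N x ≤ R → |h p σ x - (eval x (P p) - thr σ)| < η / 4 := by
    intro p σ x hx
    have h1 := hθ1 (p, σ) x hx
    simp only [h, eval_tilt_penalty_inr]
    convert h1 using 2
    ring
  have hAc : ∀ l, Continuous (A l) := fun l =>
    (differentiable_eval_mvPolynomial _).continuous.sub continuous_const
  have hhc : ∀ p σ, Continuous (h p σ) := fun p σ =>
    (differentiable_eval_mvPolynomial _).continuous.sub continuous_const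
  have hfc : Continuous f :=
    (differentiable_eval_mvPolynomial _).continuous.sub (by fun_prop)
  have hfval : ∀ x, f x = eval x Q + τ * N x - ∑ t, θ.2.2 t * x t := fun x => by
    simp only [f, hgval]
  have hmid : ∀ x, N x ≤ R → ∀ p, (h p 1 x = 0 → h p 2 x < 0) ∧ (h p 2 x = 0 → 0 < h p 1 x) := by
    intro x hx p
    have h1 := abs_lt.1 (hval p 1 x hx)
    have h2 := abs_lt.1 (hval p 2 x hx)
    simp only [thr, Matrix.cons_val] at h1 h2
    constructor <;> intro h0 <;> linarith [h1.1, h1.2, h2.1, h2.2]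
  have hexists : ∀ i, ∃ x ∈ W i, ∃ α : ι → Option (Fin 4),
      ((∀ l, A l x = 0) ∧ ∀ p σ, α p = some σ → h p σ x = 0) ∧
      IsLocalMinOn f {x | (∀ l, A l x = 0) ∧ ∀ p σ, α p = some σ → h p σ x = 0} x := by
    intro i
    obtain ⟨y, hy, hyA⟩ := exists_mem_disc_tilt_eq Q P hE θ.2.1 θ.1 (z i) (hz i) (hr i) (hrκ i)
      fun y hy => hθ2 i _ (show N _ ≤ R by linarith [(hG i y hy).2.1])
    obtain ⟨hyW, hyN, hyQ, hyP⟩ := hG i y hy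
    generalize z i + ∑ l, y l • E l = w at hyA hyW hyN hyQ hyP
    have hwR : N w ≤ R := by linarith
    have hw3 := abs_lt.1 (hθ3 w hwR)
    refine exists_isLocalMinOn_active hfc hNc hAc hhc (hWo i) hB hmid hyW hwR
      (fun l => sub_eq_zero.2 (hyA l)) (fun p => ?_) fun x hxR hxT hx => ?_
    · have h0 := abs_lt.1 (hval p 0 w hwR)
      have h1 := abs_lt.1 (hval p 1 w hwR)
      have h2 := abs_lt.1 (hval p 2 w hwR)
      have h3 := abs_lt.1 (hval p 3 w hwR)
      simp only [thr, Matrix.cons_val] at h0 h1 h2 h3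
      rcases hyP p with hp | hp
      · have := abs_lt.1 hp
        exact Or.inr (Or.inl ⟨by linarith, by linarith⟩)
      · rcases lt_abs.1 hp with hp | hp
        · exact Or.inr (Or.inr (by linarith))
        · exact Or.inl (by linarith)
    · have hx3 := abs_lt.1 (hθ3 x hxR)
      have hNw : τ * N w ≤ τ * (R - 1) := mul_le_mul_of_nonneg_left hyN.le hτ.le
      rw [hfval, hfval]
      rcases hx with hx | hx
      · have hNx : 0 ≤ τ * N x := mul_nonneg hτ.le (hN0 x)
        rcases hηW i x ⟨hx, hxR⟩ with hxQ | ⟨p, hp1, hp2⟩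
        · linarith
        · exfalso
          have h0 := abs_lt.1 (hval p 0 x hxR)
          have h1 := abs_lt.1 (hval p 1 x hxR)
          have h2 := abs_lt.1 (hval p 2 x hxR)
          have h3 := abs_lt.1 (hval p 3 x hxR)
          simp only [thr, Matrix.cons_val] at h0 h1 h2 h3
          have hp2' := abs_lt.1 hp2
          rcases hxT p with hT | hT | hT
          · linarith
          · rcases lt_abs.1 hp1 with hp | hp <;> linarith
          · linarith
      · have := hQ0 x
        rw [hx]
        linarith
  choose x hxW α hmem hmin using hexists
  have hinj : Function.Injective x := by
    intro i j hij
    by_contra hne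
    exact Set.disjoint_left.1 (hWd i j hne) (hxW i) (hij ▸ hxW j)
  simp only [A, h, sub_eq_zero] at hmem hmin
  exact card_le_of_isLocalMinOn 4 d₁ d D (by omega) hd hd₁D hdD Q g hQ hg P hP E θ hθ x hinj α
    hmem hmin

end Core

/-- The sum of squares of a finite family of polynomials. -/
noncomputable def sumSq {σ : Type*} (Qs : Finset (MvPolynomial σ ℝ)) : MvPolynomial σ ℝ :=
  ∑ q ∈ Qs, q ^ 2

theorem eval_sumSq {σ : Type*} (Qs : Finset (MvPolynomial σ ℝ)) (x : σ → ℝ) :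
    eval x (sumSq Qs) = ∑ q ∈ Qs, eval x q ^ 2 := by
  simp [sumSq, map_sum]

theorem eval_sumSq_nonneg {σ : Type*} (Qs : Finset (MvPolynomial σ ℝ)) (x : σ → ℝ) :
    0 ≤ eval x (sumSq Qs) := by
  rw [eval_sumSq]
  exact Finset.sum_nonneg fun q _ => sq_nonneg _

theorem eval_sumSq_eq_zero {σ : Type*} (Qs : Finset (MvPolynomial σ ℝ)) (x : σ → ℝ) :
    eval x (sumSq Qs) = 0 ↔ ∀ q ∈ Qs, eval x q = 0 := by
  rw [eval_sumSq, Finset.sum_eq_zero_iff_of_nonneg fun q _ => sq_nonneg _]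
  simp

theorem totalDegree_sumSq_le {σ : Type*} (Qs : Finset (MvPolynomial σ ℝ)) {d₀ : ℕ}
    (h : ∀ q ∈ Qs, q.totalDegree ≤ d₀) : (sumSq Qs).totalDegree ≤ 2 * d₀ :=
  totalDegree_finsetSum_le fun q hq =>
    (totalDegree_pow q 2).trans (Nat.mul_le_mul_left 2 (h q hq))

theorem choose_mul_sum_le (k' c a d D s : ℕ) :
    ∑ j ∈ Finset.range (s + 1), s.choose j *
      (4 ^ j * ((k' + c).choose (c + j) * (a ^ c * d ^ j) * D ^ (k' + c - (c + j)))) ≤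
    ∑ j ∈ Finset.range (k' + 1), 4 ^ j * Nat.choose (s + 1) j *
      (Nat.choose (k' + c + 1) (c + j + 1) * a ^ c * d ^ j * D ^ (k' - j)
        + 2 * (k' + c - j + 1)) := by
  have hterm : ∀ j, s.choose j *
      (4 ^ j * ((k' + c).choose (c + j) * (a ^ c * d ^ j) * D ^ (k' + c - (c + j)))) ≤
      4 ^ j * Nat.choose (s + 1) j *
      (Nat.choose (k' + c + 1) (c + j + 1) * a ^ c * d ^ j * D ^ (k' - j)
        + 2 * (k' + c - j + 1)) := by
    intro j
    have e : k' + c - (c + j) = k' - j := by omega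
    have h1 : (k' + c).choose (c + j) ≤ (k' + c + 1).choose (c + j + 1) := by
      rw [Nat.choose_succ_succ]; exact Nat.le_add_right _ _
    have h2 : s.choose j ≤ (s + 1).choose j := Nat.choose_le_succ s j
    rw [e]
    calc s.choose j * (4 ^ j * ((k' + c).choose (c + j) * (a ^ c * d ^ j) * D ^ (k' - j)))
        = 4 ^ j * s.choose j * ((k' + c).choose (c + j) * a ^ c * d ^ j * D ^ (k' - j)) := by ring
      _ ≤ 4 ^ j * (s + 1).choose j *
          ((k' + c + 1).choose (c + j + 1) * a ^ c * d ^ j * D ^ (k' - j)) := by gcongr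
      _ ≤ _ := by gcongr; exact Nat.le_add_right _ _
  calc _ ≤ ∑ j ∈ Finset.range (s + 1) ∪ Finset.range (k' + 1), s.choose j *
      (4 ^ j * ((k' + c).choose (c + j) * (a ^ c * d ^ j) * D ^ (k' + c - (c + j)))) :=
        Finset.sum_le_sum_of_subset Finset.subset_union_left
    _ = ∑ j ∈ Finset.range (k' + 1), s.choose j *
      (4 ^ j * ((k' + c).choose (c + j) * (a ^ c * d ^ j) * D ^ (k' + c - (c + j)))) := by
        refine (Finset.sum_subset Finset.subset_union_right fun j _ hj => ?_).symm
        rw [Finset.mem_range] at hj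
        rw [Nat.choose_eq_zero_of_lt (by omega : k' + c < c + j)]
        simp
    _ ≤ _ := Finset.sum_le_sum fun j _ => hterm j

/-- A finite family of points of the variety, any two of which are separated by the signs of the
polynomials `Ps`, has at most the asserted number of members. -/
theorem card_le_of_sign_separated (k' c d₀ d : ℕ) (hd₀ : 1 ≤ d₀)
    (Qs Ps : Finset (MvPolynomial (Fin (k' + c)) ℝ))
    (hQdeg : ∀ q ∈ Qs, q.totalDegree ≤ d₀) (hPdeg : ∀ p ∈ Ps, p.totalDegree ≤ d)
    (hdim : dimH {x | ∀ q ∈ Qs, eval x q = 0} ≤ (k' : ℝ≥0∞))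
    {I : Type*} [Fintype I] (z : I → Fin (k' + c) → ℝ) (hz : ∀ i, ∀ q ∈ Qs, eval (z i) q = 0)
    (hsep : ∀ i j, ∀ K ⊆ {x | ∀ q ∈ Qs, eval x q = 0}, IsPreconnected K → z i ∈ K → z j ∈ K →
      (∀ x ∈ K, ∀ p : {p // p ∈ Ps},
        SignType.sign (eval x p.1) = SignType.sign (eval (z i) p.1)) → i = j) :
    Fintype.card I ≤ ∑ j ∈ Finset.range (k' + 1), 4 ^ j * Nat.choose (Ps.card + 1) j *
      (Nat.choose (k' + c + 1) (c + j + 1) * (2 * d₀) ^ c * d ^ j * (max (2 * d₀) d) ^ (k' - j)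
        + 2 * (k' + c - j + 1)) := by
  have hset : {x | eval x (sumSq Qs) = 0} = {x | ∀ q ∈ Qs, eval x q = 0} :=
    Set.ext fun x => eval_sumSq_eq_zero Qs x
  rw [← hset] at hdim
  have hz' : ∀ i, eval (z i) (sumSq Qs) = 0 := fun i => (eval_sumSq_eq_zero Qs _).2 (hz i)
  rcases Nat.eq_zero_or_pos d with rfl | hd
  · refine (card_le_of_separated (ι := Empty) (2 * d₀) 0 (max (2 * d₀) 0) (by omega)
      (Or.inl inferInstance) (le_max_left _ _) (le_max_right _ _) (sumSq Qs)
      (eval_sumSq_nonneg Qs) (totalDegree_sumSq_le Qs hQdeg) hdim (fun p => p.elim)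
      (fun p => p.elim) z hz' fun i j K hK hpre hi hj _ => ?_).trans ?_
    · refine hsep i j K (hset ▸ hK) hpre hi hj fun x _ p => ?_
      have hp := totalDegree_eq_zero_iff_eq_C.1 (Nat.le_zero.1 (hPdeg p.1 p.2))
      rw [hp]
      simp only [eval_C]
    · refine (choose_mul_sum_le k' c (2 * d₀) 0 (max (2 * d₀) 0) _).trans ?_
      refine Finset.sum_le_sum fun j _ => ?_
      gcongr
      simp
  · refine (card_le_of_separated (ι := {p // p ∈ Ps}) (2 * d₀) d (max (2 * d₀) d) (by omega)
      (Or.inr hd) (le_max_left _ _) (le_max_right _ _) (sumSq Qs)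
      (eval_sumSq_nonneg Qs) (totalDegree_sumSq_le Qs hQdeg) hdim (fun p => p.1)
      (fun p => hPdeg p.1 p.2) z hz' fun i j K hK hpre hi hj hs =>
        hsep i j K (hset ▸ hK) hpre hi hj hs).trans ?_
    rw [Fintype.card_coe]
    exact choose_mul_sum_le k' c (2 * d₀) d (max (2 * d₀) d) _

theorem connectedComponents_mk_eq_of_isPreconnected {X : Type*} [TopologicalSpace X]
    {S K : Set X} (hK : IsPreconnected K) (hKS : K ⊆ S) {x y : S} (hx : x.1 ∈ K) (hy : y.1 ∈ K) :
    (x : ConnectedComponents S) = y := by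
  rw [ConnectedComponents.coe_eq_coe']
  have hpre : IsPreconnected ((↑) ⁻¹' K : Set S) := by
    rw [← Topology.IsInducing.subtypeVal.isPreconnected_image, Subtype.image_preimage_coe,
      Set.inter_eq_self_of_subset_right hKS]
    exact hK
  exact hpre.subset_connectedComponent hy hx

theorem finite_and_card_le_of_forall_finset {T : Type*} {N : ℕ}
    (h : ∀ F : Finset T, F.card ≤ N) : Finite T ∧ Nat.card T ≤ N := by
  have hfin : Finite T := by
    by_contra hinf
    rw [not_finite_iff_infinite] at hinf
    obtain ⟨F, hF⟩ := Infinite.exists_subset_card_eq T (N + 1)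
    have := h F
    omega
  refine ⟨hfin, ?_⟩
  have := Fintype.ofFinite T
  rw [Nat.card_eq_fintype_card]
  exact h Finset.univ

/-- bound on the total number of connected components of all
realizations of sign conditions of a family `Ps` of `s` polynomials of degree
at most `d` on a real variety `Z` of Hausdorff dimension at most `k'`. -/
theorem stmt1 (k k' d₀ d s : ℕ) (hk : 1 ≤ k) (hk' : k' ≤ k) (hd₀ : 1 ≤ d₀)
    (Qs Ps : Finset (MvPolynomial (Fin k) ℝ)) (hcard : Ps.card = s)
    (hQdeg : ∀ q ∈ Qs, q.totalDegree ≤ d₀)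
    (hPdeg : ∀ p ∈ Ps, p.totalDegree ≤ d)
    (Z : Set (Fin k → ℝ))
    (hZ : Z = {x | ∀ q ∈ Qs, MvPolynomial.eval x q = 0})
    (hdim : dimH Z ≤ (k' : ℝ≥0∞)) :
    (∀ σ : {p // p ∈ Ps} → SignType,
      Finite (ConnectedComponents
        ↥{x ∈ Z | ∀ p : {p // p ∈ Ps}, SignType.sign (MvPolynomial.eval x p.1) = σ p})) ∧
    (∑ σ : {p // p ∈ Ps} → SignType,
      Nat.card (ConnectedComponents
        ↥{x ∈ Z | ∀ p : {p // p ∈ Ps}, SignType.sign (MvPolynomial.eval x p.1) = σ p}))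
      ≤ ∑ j ∈ Finset.range (k' + 1),
          4 ^ j * Nat.choose (s + 1) j *
            (Nat.choose (k + 1) (k - k' + j + 1) * (2 * d₀) ^ (k - k') * d ^ j *
                (max (2 * d₀) d) ^ (k' - j)
              + 2 * (k - j + 1)) := by
  obtain ⟨c, rfl⟩ := Nat.exists_eq_add_of_le hk'
  subst hcard
  rw [Nat.add_sub_cancel_left]
  let R : ({p // p ∈ Ps} → SignType) → Set (Fin (k' + c) → ℝ) := fun σ =>
    {x ∈ Z | ∀ p : {p // p ∈ Ps}, SignType.sign (MvPolynomial.eval x p.1) = σ p}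
  choose z hz using fun t : Σ σ, ConnectedComponents (R σ) => ConnectedComponents.surjective_coe t.2
  have hzZ : ∀ t, ∀ q ∈ Qs, eval (z t).1 q = 0 := fun t => by
    have := (z t).2.1
    rwa [hZ] at this
  have hinj : ∀ t u, ∀ K ⊆ Z, IsPreconnected K → (z t).1 ∈ K → (z u).1 ∈ K →
      (∀ x ∈ K, ∀ p : {p // p ∈ Ps},
        SignType.sign (eval x p.1) = SignType.sign (eval (z t).1 p.1)) → t = u := by
    intro t u K hKZ hK ht hu hs
    have hσ : t.1 = u.1 := funext fun p => by
      rw [← (z t).2.2 p, ← (z u).2.2 p, hs _ hu p]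
    obtain ⟨σ, t⟩ := t
    obtain ⟨τ, u⟩ := u
    obtain rfl : σ = τ := hσ
    have hKR : K ⊆ R σ := fun x hx => ⟨hKZ hx, fun p => (hs x hx p).trans ((z ⟨σ, t⟩).2.2 p)⟩
    have := connectedComponents_mk_eq_of_isPreconnected hK hKR ht hu
    rw [hz, hz] at this
    exact congrArg (Sigma.mk σ) this
  obtain ⟨hfin, hle⟩ := finite_and_card_le_of_forall_finset fun
      F : Finset (Σ σ, ConnectedComponents (R σ)) => by
    have := card_le_of_sign_separated k' c d₀ d hd₀ Qs Ps hQdeg hPdeg (hZ ▸ hdim)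
      (fun t : F => (z t.1).1) (fun t => hzZ t.1) fun t u K hK hpre ht hu hs =>
        Subtype.ext (hinj t.1 u.1 K (hZ ▸ hK) hpre ht hu hs)
    rwa [Fintype.card_coe] at this
  have hfib : ∀ σ, Finite (ConnectedComponents (R σ)) := fun σ =>
    Finite.of_injective (Sigma.mk σ : _ → Σ σ, ConnectedComponents (R σ)) sigma_mk_injective
  exact ⟨hfib, by rwa [Nat.card_sigma] at hle⟩
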